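/- There exists a constant c = c(r) ∈ ℕ depending only on r such that whenever p > c the following holds: for every nonzero prime ideal 𝔩 of A with 𝔩 ≠ (T) (the places where φ has good reduction), the mod 𝔩 Galois representation is either reducible or surjective; that is, either there exists an 𝔽_𝔩-subspace X of φ[𝔩] with X ≠ 0, X ≠ φ[𝔩], and σ(X) = X for all σ ∈ Gal(F̄/F), or every 𝔽_𝔩-linear automorphism of φ[𝔩] is the restriction of some σ ∈ Gal(F̄/F). -/

import Mathlib

open Polynomial

noncomputable section

/-- `F̄`: a fixed algebraic closure of `F = 𝔽_q(T)`. -/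
abbrev Kbar (Fq : Type) [Field Fq] := AlgebraicClosure (RatFunc Fq)

/-- `φ` is (encodes) the rank-`r` Drinfeld `𝔽_q[T]`-module over `𝔽_q(T)` given by
`φ_T = T + τ^{r-1} + T^{q-1} τ^r`: it is a ring homomorphism from `A = 𝔽_q[T]` to the
additive endomorphisms of `F̄` which is `𝔽_q`-linear (the condition on `C c`) and sends
`T` to `x ↦ T·x + x^{q^{r-1}} + T^{q-1}·x^{q^r}`. -/
def IsDrinfeldPhi (Fq : Type) [Field Fq] (q r : ℕ)
    (φ : Polynomial Fq →+* AddMonoid.End (Kbar Fq)) : Prop :=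
  (∀ (c : Fq) (x : Kbar Fq),
      φ (C c) x = algebraMap (RatFunc Fq) (Kbar Fq) (RatFunc.C c) * x) ∧
  (∀ x : Kbar Fq, φ X x =
      algebraMap (RatFunc Fq) (Kbar Fq) RatFunc.X * x + x ^ q ^ (r - 1) +
        algebraMap (RatFunc Fq) (Kbar Fq) RatFunc.X ^ (q - 1) * x ^ q ^ r)

/-- The `a`-torsion `φ[a] ⊆ F̄`. -/
def phiTorsion (Fq : Type) [Field Fq] (φ : Polynomial Fq →+* AddMonoid.End (Kbar Fq))
    (a : Polynomial Fq) : Set (Kbar Fq) := {x | φ a x = 0}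

/-- `g` is an `A/(a)`-module automorphism of `φ[a]`: a bijection of `φ[a]` with itself
which is additive and commutes with the `A`-action through `φ`. -/
def IsTorsionAut (Fq : Type) [Field Fq] (φ : Polynomial Fq →+* AddMonoid.End (Kbar Fq))
    (a : Polynomial Fq) (g : Kbar Fq → Kbar Fq) : Prop :=
  Set.BijOn g (phiTorsion Fq φ a) (phiTorsion Fq φ a) ∧
  (∀ x ∈ phiTorsion Fq φ a, ∀ y ∈ phiTorsion Fq φ a, g (x + y) = g x + g y) ∧
  (∀ b : Polynomial Fq, ∀ x ∈ phiTorsion Fq φ a, g (φ b x) = φ b (g x))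

/-- `V` is a Galois-stable `𝔽_𝔩`-subspace of `φ[𝔩]` (for `𝔩 = (l)`): a subset of the
`l`-torsion containing `0`, closed under addition and under the `A`-action through `φ`
(hence an `A/𝔩 = 𝔽_𝔩`-subspace), and stable under `Gal(F̄/F)`. -/
def IsGaloisStableSubspace (Fq : Type) [Field Fq]
    (φ : Polynomial Fq →+* AddMonoid.End (Kbar Fq)) (l : Polynomial Fq)
    (V : Set (Kbar Fq)) : Prop :=
  V ⊆ phiTorsion Fq φ l ∧ (0 : Kbar Fq) ∈ V ∧
  (∀ x ∈ V, ∀ y ∈ V, x + y ∈ V) ∧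
  (∀ b : Polynomial Fq, ∀ x ∈ V, φ b x ∈ V) ∧
  (∀ σ : Kbar Fq ≃ₐ[RatFunc Fq] Kbar Fq, ∀ x ∈ V, σ x ∈ V)

open Matrix in
theorem Matrix.SpecialLinearGroup.diag2n_eq_transvection_prod {ι F : Type*} [Fintype ι]
    [DecidableEq ι] [Field F] {i j : ι} (hij : i ≠ j) {c : F} (hc : c ≠ 0) :
    SpecialLinearGroup.diag2n hij c hc =
      transvection hij c * transvection hij.symm (-c⁻¹) * transvection hij c *
        transvection hij (-1) * transvection hij.symm 1 * transvection hij (-1) := by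
  have h : ∀ (x y z w : ι) (a b : F), single x y a * single z w b =
      if y = z then single x w (a * b) else 0 := by
    intro x y z w a b
    split_ifs with h
    · rw [h, single_mul_single_same]
    · exact single_mul_single_of_ne _ _ _ _ h _
  ext k l
  simp only [SpecialLinearGroup.coe_mul, transvection_coe, add_mul, mul_add, one_mul, mul_one, h,
    add_zero, if_true, hij, hij.symm, if_false]
  simp only [diag2n_coe, diagonal_apply, single_apply, Matrix.add_apply, one_apply]
  by_cases hk : k = l
  · subst hk
    by_cases h3 : k = i
    · subst h3
      simp [hij.symm, hc]
    · by_cases h4 : k = j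
      · subst h4
        simp [hij, hij.symm, hc]
      · simp [h3, h4, Ne.symm h3, Ne.symm h4]
  · have h1 : ¬ (i = k ∧ i = l) := fun h ↦ hk (h.1.symm.trans h.2)
    have h2 : ¬ (j = k ∧ j = l) := fun h ↦ hk (h.1.symm.trans h.2)
    by_cases h3 : i = k ∧ j = l <;> by_cases h4 : j = k ∧ i = l <;>
      simp [hk, Ne.symm hk, h1, h2, h3, h4, hc]

open Module in
/-- A subgroup of `GL(V)` acting irreducibly and containing all transvections with a given axis
contains all transvections. -/
theorem transvection_mem_of_irreducible {k V : Type*} [Field k] [AddCommGroup V] [Module k V]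
    [FiniteDimensional k V] (Γ : Subgroup (V ≃ₗ[k] V))
    (hirr : ∀ W : Submodule k V, (∀ g ∈ Γ, ∀ x ∈ W, g x ∈ W) → W = ⊥ ∨ W = ⊤)
    (f : Dual k V) (hf : f ≠ 0)
    (htr : ∀ (w : V) (h : f w = 0), LinearEquiv.transvection h ∈ Γ)
    (f' : Dual k V) (w : V) (h : f' w = 0) : LinearEquiv.transvection h ∈ Γ := by
  let P : Dual k V → Prop := fun f ↦ ∀ (w : V) (h : f w = 0), LinearEquiv.transvection h ∈ Γ
  have hsmul : ∀ (c : k) (f : Dual k V), P f → P (c • f) := by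
    intro c f hf w h
    have : LinearEquiv.transvection h =
        LinearEquiv.transvection (f := f) (v := c • w) (by simpa using h) := by
      ext x
      simp [LinearMap.transvection.apply, smul_smul, mul_comm]
    rw [this]
    exact hf _ _
  have hadd : ∀ f f' : Dual k V, P f → P f' → P (f + f') := by
    intro f f' hf hf' v hv
    by_cases hker : LinearMap.ker f ≤ LinearMap.ker f'
    · obtain ⟨c, rfl⟩ : ∃ c : k, c • f = f' := by
        have := mem_span_of_iInf_ker_le_ker (L := fun _ : Unit ↦ f) (K := f') (by simpa using hker)
        simpa [Submodule.mem_span_singleton] using this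
      have := hsmul (1 + c) f hf
      rw [add_smul, one_smul] at this
      exact this v hv
    · obtain ⟨w, hw, hw'⟩ := SetLike.not_le_iff_exists.1 hker
      simp only [LinearMap.mem_ker] at hw hw'
      have hw1 : f ((f' w)⁻¹ • w) = 0 := by simp [hw]
      set t := LinearEquiv.transvection hw1 with ht
      have htx : ∀ x, f' (t x) = (f + f') x := by
        intro x
        simp [ht, LinearMap.transvection.apply, hw', add_comm]
      have hv' : f' (t v) = 0 := by rw [htx, hv]
      have : LinearEquiv.transvection hv = t⁻¹ * LinearEquiv.transvection hv' * t := by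
        rw [mul_assoc, eq_inv_mul_iff_mul_eq]
        ext x
        simp only [LinearEquiv.mul_apply, LinearEquiv.transvection.apply, map_add, map_smul, htx]
      rw [this]
      exact Γ.mul_mem (Γ.mul_mem (Γ.inv_mem (hf _ _)) (hf' _ _)) (hf _ _)
  let S : Submodule k (Dual k V) :=
    { carrier := {f | P f}
      add_mem' := fun {a b} ha hb ↦ hadd a b ha hb
      zero_mem' := by
        intro w h
        have : LinearEquiv.transvection h = 1 := LinearEquiv.transvection.of_left_eq_zero w _
        rw [this]
        exact Γ.one_mem
      smul_mem' := fun c f hf ↦ hsmul c f hf }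
  have hS : ∀ g ∈ Γ, ∀ f ∈ S, f ∘ₗ (g : V →ₗ[k] V) ∈ S := by
    intro g hg f hf w h
    have h' : f (g w) = 0 := by simpa using h
    have : LinearEquiv.transvection h = g⁻¹ * LinearEquiv.transvection h' * g := by
      rw [mul_assoc, eq_inv_mul_iff_mul_eq]
      ext x
      simp [LinearMap.transvection.apply]
    rw [this]
    exact Γ.mul_mem (Γ.mul_mem (Γ.inv_mem hg) (hf _ _)) hg
  rcases hirr S.dualCoannihilator (by
    intro g hg x hx
    rw [Submodule.mem_dualCoannihilator] at hx ⊢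
    exact fun f hf ↦ hx _ (hS g hg f hf)) with h0 | h0
  · have : S = ⊤ := by
      have := Subspace.dualCoannihilator_dualAnnihilator_eq (W := S)
      rw [h0, Submodule.dualAnnihilator_bot] at this
      exact this.symm
    have hf' : f' ∈ S := this ▸ Submodule.mem_top
    exact hf' w h
  · exfalso
    apply hf
    ext x
    have : x ∈ S.dualCoannihilator := h0 ▸ Submodule.mem_top
    exact (Submodule.mem_dualCoannihilator _).1 this f htr

open Module in
/-- An irreducible subgroup of `GL(V)` with full determinant which contains all transvections with
a given axis is `GL(V)`. -/
theorem eq_top_of_irreducible_of_transvection {k V : Type*} [Field k] [AddCommGroup V] [Module k V]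
    [FiniteDimensional k V] (h2 : 2 ≤ finrank k V) (Γ : Subgroup (V ≃ₗ[k] V))
    (hirr : ∀ W : Submodule k V, (∀ g ∈ Γ, ∀ x ∈ W, g x ∈ W) → W = ⊥ ∨ W = ⊤)
    (f : Dual k V) (hf : f ≠ 0)
    (htr : ∀ (w : V) (h : f w = 0), LinearEquiv.transvection h ∈ Γ)
    (hdet : ∀ u : k, u ≠ 0 → ∃ g ∈ Γ, LinearMap.det (g : V →ₗ[k] V) = u) : Γ = ⊤ := by
  have key := transvection_mem_of_irreducible Γ hirr f hf htr
  have hSL : ∀ g : V ≃ₗ[k] V, LinearMap.det (g : V →ₗ[k] V) = 1 → g ∈ Γ := by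
    intro g hg
    let b := finBasis k V
    have : Nontrivial (Fin (finrank k V)) := Fin.nontrivial_iff_two_le.2 h2
    let M : Matrix.SpecialLinearGroup (Fin (finrank k V)) k :=
      ⟨LinearMap.toMatrix b b g, by rw [LinearMap.det_toMatrix, hg]⟩
    have hT : ∀ (i j : Fin (finrank k V)) (hij : i ≠ j) (a : k), ∃ γ ∈ Γ,
        LinearMap.toMatrix b b (γ : V →ₗ[k] V) =
          (Matrix.SpecialLinearGroup.transvection hij a).1 := by
      intro i j hij a
      refine ⟨_, key (b.coord j) (a • b i) (by simp [hij]), ?_⟩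
      rw [Matrix.SpecialLinearGroup.transvection_coe]
      ext k l
      simp only [LinearMap.toMatrix_apply, LinearEquiv.coe_coe, LinearEquiv.transvection.apply,
        Matrix.one_apply, Matrix.single_apply, Finsupp.single_apply, Matrix.add_apply, map_add,
        map_smul, Finsupp.add_apply, Finsupp.smul_apply, Module.Basis.repr_self,
        Module.Basis.coord_apply, smul_eq_mul]
      grind
    have hM : ∀ A B : Matrix.SpecialLinearGroup (Fin (finrank k V)) k,
        (∃ γ ∈ Γ, LinearMap.toMatrix b b (γ : V →ₗ[k] V) = A.1) →
        (∃ γ ∈ Γ, LinearMap.toMatrix b b (γ : V →ₗ[k] V) = B.1) →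
        (∃ γ ∈ Γ, LinearMap.toMatrix b b (γ : V →ₗ[k] V) = (A * B).1) := by
      rintro A B ⟨γ, hγ, hA⟩ ⟨δ, hδ, hB⟩
      refine ⟨γ * δ, Γ.mul_mem hγ hδ, ?_⟩
      rw [Matrix.SpecialLinearGroup.coe_mul, ← hA, ← hB, ← LinearMap.toMatrix_comp]
      rfl
    obtain ⟨γ, hγ, h⟩ := Matrix.SpecialLinearGroup.diagonal_transvection_induction'
      (fun M ↦ ∃ γ ∈ Γ, LinearMap.toMatrix b b (γ : V →ₗ[k] V) = M.1) M
      (fun i j hij c hc ↦ by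
        rw [Matrix.SpecialLinearGroup.diag2n_eq_transvection_prod]
        exact hM _ _ (hM _ _ (hM _ _ (hM _ _ (hM _ _ (hT _ _ _ _) (hT _ _ _ _)) (hT _ _ _ _))
          (hT _ _ _ _)) (hT _ _ _ _)) (hT _ _ _ _)) hT hM
    have : γ = g := by
      apply LinearEquiv.toLinearMap_injective
      exact (LinearMap.toMatrix b b).injective h
    exact this ▸ hγ
  rw [Subgroup.eq_top_iff']
  intro g
  obtain ⟨g₀, hg₀, h⟩ := hdet _ (LinearEquiv.isUnit_det' g).ne_zero
  have : g₀⁻¹ * g ∈ Γ := by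
    apply hSL
    have h1 : g₀ * (g₀⁻¹ * g) = g := by group
    have h3 := congrArg (fun e : V ≃ₗ[k] V ↦ LinearMap.det (e : V →ₗ[k] V)) h1
    have h4 : ((g₀ * (g₀⁻¹ * g) : V ≃ₗ[k] V) : V →ₗ[k] V) =
      (g₀ : V →ₗ[k] V) * ((g₀⁻¹ * g : V ≃ₗ[k] V) : V →ₗ[k] V) := rfl
    simp only [h4, map_mul, h] at h3
    exact mul_left_cancel₀ (LinearEquiv.isUnit_det' g).ne_zero (h3.trans (mul_one _).symm)
  have := Γ.mul_mem hg₀ this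
  rwa [mul_inv_cancel_left] at this

open IsDedekindDomain Algebra in
theorem valuation_algebraMap_eq_pow_card_inertia {R S K L G : Type*} [CommRing R]
    [IsDedekindDomain R] [CommRing S] [IsDedekindDomain S] [Algebra R S] [Module.IsTorsionFree R S]
    [Field K] [Field L] [Algebra K L] [Algebra R K] [IsFractionRing R K] [Algebra R L]
    [IsScalarTower R K L] [Algebra S L] [IsFractionRing S L] [IsScalarTower R S L]
    [Group G] [Finite G] [MulSemiringAction G S] [MulSemiringAction G L] [SMulDistribClass G S L]
    [IsGaloisGroup G K L] [Module.Finite R S]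
    (P : HeightOneSpectrum S) (p : HeightOneSpectrum R) [P.asIdeal.LiesOver p.asIdeal]
    [Finite (R ⧸ p.asIdeal)] (x : K) :
    P.valuation L (algebraMap K L x) =
      p.valuation K x ^ Nat.card (P.asIdeal.inertia G) := by
  have : IsGaloisGroup G R S := IsGaloisGroup.of_isFractionRing G R S K L
  have := p.isPrime
  have := P.isPrime
  have hpmax : p.asIdeal.IsMaximal := p.isMaximal
  have hfin : Finite p.asIdeal.ResidueField :=
    Finite.of_surjective _ p.asIdeal.bijective_algebraMap_quotient_residueField.2
  rw [Ideal.card_inertia_eq_ramificationIdxIn (R := R) p.asIdeal P.asIdeal,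
    Ideal.ramificationIdxIn_eq_ramificationIdx p.asIdeal P.asIdeal G,
    ← Ideal.ramificationIdx'_eq_ramificationIdx' p.asIdeal P.asIdeal ?_,
    HeightOneSpectrum.valuation_liesOver L p P]
  rw [Ne, Ideal.map_eq_bot_iff_of_injective (FaithfulSMul.algebraMap_injective R S)]
  exact p.ne_bot

open IsDedekindDomain Algebra in
theorem exists_valuation_algebraMap_eq_pow_card_inertia {A F E L S G : Type*} [CommRing A]
    [IsDedekindDomain A] [CommRing S] [IsDedekindDomain S] [Algebra A S]
    [Field F] [Field E] [Field L] [Algebra A F] [IsFractionRing A F] [Algebra F E]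
    [Algebra F L] [Algebra E L] [IsScalarTower F E L] [FiniteDimensional F E]
    [Algebra.IsSeparable F E] [Algebra A E] [IsScalarTower A F E] [Algebra A L]
    [IsScalarTower A E L] [Algebra S L]
    [IsIntegralClosure S A L] [IsFractionRing S L] [IsScalarTower A S L] [Module.Finite A S]
    [Group G] [Finite G] [MulSemiringAction G S] [MulSemiringAction G L] [SMulDistribClass G S L]
    [IsGaloisGroup G E L]
    (P : HeightOneSpectrum S) (p : HeightOneSpectrum A) [P.asIdeal.LiesOver p.asIdeal]
    [Finite (A ⧸ p.asIdeal)] :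
    ∃ u : Valuation E (WithZero (Multiplicative ℤ)), ∀ x : E,
      P.valuation L (algebraMap E L x) = u x ^ Nat.card (P.asIdeal.inertia G) := by
  have hAE : FaithfulSMul A E := by
    rw [faithfulSMul_iff_algebraMap_injective, IsScalarTower.algebraMap_eq A F E]
    exact (algebraMap F E).injective.comp (IsFractionRing.injective A F)
  let R := integralClosure A E
  have hR : IsDedekindDomain R := integralClosure.isDedekindDomain A F E
  have hRK : IsFractionRing R E := integralClosure.isFractionRing_of_finite_extension F E
  have hRfin : Module.Finite A R := IsIntegralClosure.finite A F E R
  have : IsScalarTower R E L := inferInstance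
  have : IsScalarTower A R L := IsScalarTower.of_algebraMap_eq fun a ↦
    IsScalarTower.algebraMap_apply A E L a
  let g : R →ₐ[A] S := IsIntegralClosure.lift A S L
  let _ : Algebra R S := g.toRingHom.toAlgebra
  have : IsScalarTower A R S := IsScalarTower.of_algebraMap_eq fun a ↦ (g.commutes a).symm
  have : IsScalarTower R S L := IsScalarTower.of_algebraMap_eq fun a ↦
    (IsIntegralClosure.algebraMap_lift A S L a).symm
  have : FaithfulSMul R S := by
    rw [faithfulSMul_iff_algebraMap_injective]
    refine Function.Injective.of_comp (f := algebraMap S L) ?_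
    rw [← RingHom.coe_comp, ← IsScalarTower.algebraMap_eq, IsScalarTower.algebraMap_eq R E L]
    exact (algebraMap E L).injective.comp (IsFractionRing.injective R E)
  have : Module.Finite R S := Module.Finite.of_restrictScalars_finite A R S
  have hpR : (P.asIdeal.under R).LiesOver p.asIdeal := inferInstance
  let p' : HeightOneSpectrum R := ⟨P.asIdeal.under R, inferInstance,
    Ideal.ne_bot_of_liesOver_of_ne_bot p.ne_bot (P.asIdeal.under R)⟩
  have : P.asIdeal.LiesOver p'.asIdeal := ⟨rfl⟩
  have : p'.asIdeal.LiesOver p.asIdeal := hpR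
  have : Finite (R ⧸ p'.asIdeal) := Module.finite_of_finite (A ⧸ p.asIdeal)
  exact ⟨p'.valuation E, valuation_algebraMap_eq_pow_card_inertia P p'⟩

open IsDedekindDomain WithZero in
theorem exists_valuation_inertia {A F L : Type*} [CommRing A] [IsDedekindDomain A] [Field F]
    [Algebra A F] [IsFractionRing A F] [Field L] [Algebra F L] [FiniteDimensional F L]
    [IsGalois F L] [Algebra A L] [IsScalarTower A F L] (p : HeightOneSpectrum A)
    [Finite (A ⧸ p.asIdeal)] :
    ∃ (v : Valuation L (WithZero (Multiplicative ℤ))) (I : Subgroup (L ≃ₐ[F] L)),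
      (∀ a : A, v (algebraMap A L a) ≤ 1) ∧
      (∀ a : A, v (algebraMap A L a) < 1 ↔ a ∈ p.asIdeal) ∧
      (∀ σ ∈ I, ∀ x, v (σ x) = v x) ∧
      (∀ σ ∈ I, ∀ x, v x ≤ 1 → v (σ x - x) < 1) ∧
      (∀ y : F, v (algebraMap F L y) = p.valuation F y ^ Nat.card I) ∧
      (∀ y : L, y ≠ 0 → (∀ σ ∈ I, σ y = y) → ∃ n : ℤ, v y = exp (n * Nat.card I)) := by
  let S := integralClosure A L
  have hS : IsDedekindDomain S := integralClosure.isDedekindDomain A F L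
  have hSL : IsFractionRing S L := integralClosure.isFractionRing_of_finite_extension F L
  have hfin : Module.Finite A S := IsIntegralClosure.finite A F L S
  have hAL : FaithfulSMul A L := by
    rw [faithfulSMul_iff_algebraMap_injective, IsScalarTower.algebraMap_eq A F L]
    exact (algebraMap F L).injective.comp (IsFractionRing.injective A F)
  have hAS : Module.IsTorsionFree A S := inferInstance
  obtain ⟨P, hP, hPp⟩ : ∃ P : Ideal S, P.IsPrime ∧ P.LiesOver p.asIdeal := by
    have := p.isPrime
    obtain ⟨⟨P, h1, h2⟩⟩ := (inferInstance : Nonempty (p.asIdeal.primesOver S))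
    exact ⟨P, h1, h2⟩
  let w : HeightOneSpectrum S := ⟨P, hP, Ideal.ne_bot_of_liesOver_of_ne_bot p.ne_bot P⟩
  have hw : w.asIdeal.LiesOver p.asIdeal := hPp
  have hv : ∀ a : A, w.valuation L (algebraMap A L a) = w.intValuation (algebraMap A S a) := by
    intro a
    rw [IsScalarTower.algebraMap_apply A S L, HeightOneSpectrum.valuation_of_algebraMap]
  let I := P.inertia (L ≃ₐ[F] L)
  have hσle : ∀ σ ∈ I, ∀ s : S, w.intValuation (σ • s) ≤ w.intValuation s := by
    intro σ hσ s
    have hmem : ∀ s ∈ P, σ • s ∈ P := fun s hs ↦ by simpa using P.add_mem (hσ s) hs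
    have hpow : ∀ n : ℕ, ∀ s ∈ P ^ n, σ • s ∈ P ^ n := by
      intro n s hs
      have hmap : P.map (MulSemiringAction.toRingHom (L ≃ₐ[F] L) S σ) ≤ P :=
        Ideal.map_le_iff_le_comap.2 hmem
      have := Ideal.mem_map_of_mem (MulSemiringAction.toRingHom (L ≃ₐ[F] L) S σ) hs
      rw [Ideal.map_pow] at this
      exact Ideal.pow_right_mono hmap n this
    rcases eq_or_ne s 0 with rfl | hs
    · simp
    rw [w.intValuation_if_neg hs, w.intValuation_le_pow_iff_mem]
    apply hpow
    rw [← w.intValuation_le_pow_iff_mem, w.intValuation_if_neg hs]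
  have hσS : ∀ σ ∈ I, ∀ s : S, w.intValuation (σ • s) = w.intValuation s := by
    intro σ hσ s
    refine le_antisymm (hσle σ hσ s) ?_
    simpa using hσle σ⁻¹ (I.inv_mem hσ) (σ • s)
  have hσv : ∀ σ ∈ I, ∀ x, w.valuation L (σ x) = w.valuation L x := by
    intro σ hσ x
    obtain ⟨a, b, hb, rfl⟩ := IsFractionRing.div_surjective (A := S) x
    have h (s : S) : σ (algebraMap S L s) = algebraMap S L (σ • s) := rfl
    rw [map_div₀, map_div₀, map_div₀, h, h]
    simp only [HeightOneSpectrum.valuation_of_algebraMap, hσS σ hσ]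
  refine ⟨w.valuation L, I, ?_, ?_, hσv, ?_, ?_, ?_⟩
  · intro a
    rw [hv]
    exact w.intValuation_le_one _
  · intro a
    rw [hv, w.intValuation_lt_one_iff_mem, ← Ideal.mem_comap, ← Ideal.under_def,
      ← hw.over]
  · intro σ hσ x hx
    obtain ⟨s, hs⟩ := w.exists_valuation_sub_lt_of_integer (K := L) hx 1
    have h1 : σ x - x = (algebraMap S L (σ • s - s)) + ((algebraMap S L s - x) -
        σ (algebraMap S L s - x)) := by
      rw [map_sub, map_sub]
      change _ = (σ (algebraMap S L s) - _) + _
      ring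
    rw [h1]
    rw [Units.val_one] at hs
    refine (w.valuation L).map_add_lt ?_ ((w.valuation L).map_sub_lt hs ?_)
    · rw [HeightOneSpectrum.valuation_lt_one_iff_mem]
      exact hσ s
    · rwa [hσv σ hσ]
  · intro y
    exact valuation_algebraMap_eq_pow_card_inertia (G := L ≃ₐ[F] L) w p y
  · intro y hy hI
    let K' : IntermediateField F L := FixedPoints.intermediateField I
    have : IsScalarTower A K' L := IsScalarTower.of_algebraMap_eq fun a ↦ rfl
    have : IsGaloisGroup I K' L := IsGaloisGroup.subgroup (L ≃ₐ[F] L) F L I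
    obtain ⟨u, hu⟩ := exists_valuation_algebraMap_eq_pow_card_inertia (F := F) (E := K') (L := L)
      (G := I) w p
    have key := hu ⟨y, fun σ ↦ hI σ σ.2⟩
    have hcard : w.asIdeal.inertia I = ⊤ := by
      rw [eq_top_iff]
      intro σ _ s
      exact σ.2 s
    rw [hcard, Subgroup.card_top] at key
    have hy' : u (⟨y, fun σ ↦ hI σ σ.2⟩ : K') ≠ 0 := by
      rw [Valuation.ne_zero_iff]
      simpa [← Subtype.coe_inj] using hy
    refine ⟨log (u (⟨y, fun σ ↦ hI σ σ.2⟩ : K')), ?_⟩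
    rw [mul_comm, ← smul_eq_mul, natCast_zsmul, exp_nsmul, exp_log hy']
    exact key

section Transvection

variable {k V G : Type*} [Field k] [AddCommGroup V] [Module k V] [Group G]

/-- A finite group of order divisible by `|ker f|` acting faithfully and trivially on the
hyperplane `ker f` contains all transvections along `ker f`. -/
theorem transvection_mem_range [Finite k] [Finite V] (ρ : G →* (V ≃ₗ[k] V))
    (hρ : Function.Injective ρ) {f : Module.Dual k V} (hf : f ≠ 0) (I : Subgroup G)
    (hI : ∀ σ ∈ I, ∀ x, f x = 0 → ρ σ x = x)
    (hdvd : Nat.card (LinearMap.ker f) ∣ Nat.card I) {w : V} (h : f w = 0) :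
    LinearEquiv.transvection h ∈ ρ.range := by
  have hG : Finite G := Finite.of_injective (fun g ↦ (ρ g : V → V))
    (DFunLike.coe_injective.comp hρ)
  obtain ⟨v₁, hv₁⟩ : ∃ v, f v ≠ 0 := by
    by_contra! h
    exact hf (LinearMap.ext h)
  obtain ⟨v₀, hv₀⟩ : ∃ v, f v = 1 := ⟨(f v₁)⁻¹ • v₁, by simp [hv₁]⟩
  have hdec : ∀ σ ∈ I, ∀ x, ρ σ x = f x • ρ σ v₀ + (x - f x • v₀) := by
    intro σ hσ x
    have h1 := hI σ hσ (x - f x • v₀) (by simp [hv₀])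
    rw [map_sub, map_smul, sub_eq_iff_eq_add'] at h1
    exact h1
  let χ : I →* k :=
    { toFun := fun σ ↦ f (ρ σ v₀)
      map_one' := by simp [hv₀]
      map_mul' := fun σ τ ↦ by
        have h1 := hdec σ σ.2 (ρ τ v₀)
        rw [Subgroup.coe_mul, map_mul, LinearEquiv.mul_apply, h1]
        simp [hv₀, mul_comm] }
  have hχ : ∀ σ : I, σ ∈ χ.toHomUnits.ker ↔ f (ρ σ v₀) = 1 := fun σ ↦ by
    rw [MonoidHom.mem_ker, Units.ext_iff]
    rfl
  have hcop : (Nat.card (LinearMap.ker f)).Coprime (Nat.card χ.toHomUnits.range) := by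
    have h1 : Nat.card χ.toHomUnits.range ∣ Nat.card k - 1 := by
      rw [← Nat.card_units]
      exact Subgroup.card_subgroup_dvd_card _
    refine Nat.Coprime.coprime_dvd_right h1 ?_
    rw [Module.natCard_eq_pow_finrank (K := k)]
    refine Nat.Coprime.pow_left _ ?_
    rw [Nat.coprime_self_sub_right Nat.card_pos]
    exact Nat.coprime_one_right _
  have hker : Nat.card (LinearMap.ker f) ∣ Nat.card χ.toHomUnits.ker := by
    refine hcop.dvd_of_dvd_mul_right ?_
    rwa [← Subgroup.index_ker, Subgroup.card_mul_index]
  let g : χ.toHomUnits.ker → LinearMap.ker f := fun σ ↦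
    ⟨ρ σ v₀ - v₀, by rw [LinearMap.mem_ker, map_sub, (hχ σ).1 σ.2, hv₀, sub_self]⟩
  have hg : Function.Injective g := by
    intro σ τ hστ
    have h1 : ρ (σ : I) v₀ = ρ (τ : I) v₀ := sub_left_injective (Subtype.ext_iff.1 hστ)
    apply Subtype.ext
    apply Subtype.ext
    apply hρ
    ext x
    rw [hdec _ (σ : I).2, hdec _ (τ : I).2, h1]
  have hbij : Function.Bijective g := by
    refine (Nat.bijective_iff_injective_and_card g).2 ⟨hg, le_antisymm ?_ ?_⟩
    · exact Nat.card_le_card_of_injective g hg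
    · exact Nat.le_of_dvd Nat.card_pos hker
  obtain ⟨σ, hσ⟩ := hbij.2 ⟨w, h⟩
  refine ⟨σ, ?_⟩
  ext x
  have h1 : ρ (σ : I) v₀ = v₀ + w := sub_eq_iff_eq_add'.1 (Subtype.ext_iff.1 hσ)
  rw [hdec _ (σ : I).2, h1, LinearEquiv.transvection.apply, smul_add]
  abel

end Transvection

section Det

variable {k V κ : Type*} [Field k] [AddCommGroup V] [Module k V] [Field κ] [Algebra k κ]

/-- If a set of automorphisms acts on a subspace `W` as the nonzero elements of a finite field and
trivially on the quotient by `W`, all determinants occur. -/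
theorem exists_det_eq_of_transitive [Finite k] [Finite V] (W : Submodule k V) (j : W →ₗ[k] κ)
    (hj : Function.Injective j) (Γ : Set (V ≃ₗ[k] V)) (hQ : ∀ g ∈ Γ, ∀ x, g x - x ∈ W)
    (hW : ∀ g ∈ Γ, ∀ x ∈ W, g x ∈ W) (x₀ : W) (hx₀ : j x₀ = 1)
    (hmul : ∀ g (hg : g ∈ Γ) (x : W),
      j ⟨g x, hW g hg x x.2⟩ = j ⟨g x₀, hW g hg x₀ x₀.2⟩ * j x)
    (htrans : ∀ x : W, x ≠ 0 → ∃ g ∈ Γ, g x₀ = x) {u : k} (hu : u ≠ 0) :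
    ∃ g ∈ Γ, LinearMap.det (g : V →ₗ[k] V) = u := by
  let S : Subalgebra k κ :=
    { LinearMap.range j with
      mul_mem' := by
        rintro _ _ ⟨x, rfl⟩ ⟨y, rfl⟩
        rcases eq_or_ne x 0 with rfl | hx
        · exact ⟨0, by simp⟩
        obtain ⟨g, hg, hgx⟩ := htrans x hx
        exact ⟨⟨g y, hW g hg y y.2⟩, by rw [hmul g hg y]; congr 2; exact Subtype.ext hgx⟩
      algebraMap_mem' := fun c ↦ ⟨c • x₀, by
        rw [map_smul, hx₀, Algebra.smul_def, mul_one]⟩ }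
  let e : W ≃ₗ[k] S := LinearEquiv.ofInjective j hj
  have he : ∀ x, (e x : κ) = j x := fun x ↦ rfl
  have _ : Finite S := Finite.of_equiv W e.toEquiv
  let _ : Field S := { (inferInstance : CommRing S) with
    inv := fun x ↦ (Finite.isField_of_domain S).toField.inv x
    mul_inv_cancel := (Finite.isField_of_domain S).toField.mul_inv_cancel
    inv_zero := (Finite.isField_of_domain S).toField.inv_zero
    exists_pair_ne := ⟨0, 1, zero_ne_one⟩
    nnqsmul := _
    nnqsmul_def := fun _ _ ↦ rfl
    qsmul := _
    qsmul_def := fun _ _ ↦ rfl }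
  obtain ⟨s, hs⟩ := FiniteField.norm_surjective k S u
  have hs0 : e.symm s ≠ 0 := by
    rintro h
    rw [LinearEquiv.map_eq_zero_iff] at h
    rw [h, Algebra.norm_zero] at hs
    exact hu hs.symm
  obtain ⟨g, hg, hgx⟩ := htrans _ hs0
  refine ⟨g, hg, ?_⟩
  have hle : W ≤ W.comap (g : V →ₗ[k] V) := fun x hx ↦ hW g hg x hx
  have h1 : W.mapQ W (g : V →ₗ[k] V) hle = LinearMap.id := by
    ext x
    simp only [LinearMap.comp_apply, Submodule.mkQ_apply, Submodule.mapQ_apply, LinearMap.id_apply]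
    exact (Submodule.Quotient.eq W).2 (hQ g hg x)
  have h2 : (g : V →ₗ[k] V).restrict hle =
      (e.symm : S →ₗ[k] W) ∘ₗ LinearMap.mulLeft k s ∘ₗ (e.symm.symm : W →ₗ[k] S) := by
    ext1 x
    apply e.injective
    apply Subtype.ext
    have h3 : (⟨g x₀, hW g hg x₀ x₀.2⟩ : W) = e.symm s := Subtype.ext hgx
    have h4 := hmul g hg x
    rw [h3, ← he (e.symm s), e.apply_symm_apply] at h4
    simp only [LinearMap.comp_apply, LinearEquiv.coe_coe, LinearEquiv.apply_symm_apply,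
      LinearMap.mulLeft_apply, LinearEquiv.symm_symm]
    exact h4
  rw [LinearMap.det_eq_det_mul_det W _ hle, h1, LinearMap.det_id, mul_one, h2, ← hs,
    LinearMap.det_conj]
  rfl

end Det

namespace Drinfeld

variable {Fq : Type*} [Field Fq] [Fintype Fq] (r : ℕ)

local notation "q" => Fintype.card Fq

set_option linter.unusedSectionVars false

section Basic

variable (E : Type*) [CommRing E] [Algebra Fq E] [Algebra Fq[X] E] [IsScalarTower Fq Fq[X] E]

/-- The operator `T + τ ^ (r - 1) + T ^ (q - 1) τ ^ r` on an `𝔽_q[T]`-algebra. -/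
def phiT : Module.End Fq E :=
  LinearMap.mulLeft Fq (algebraMap Fq[X] E X) +
    (FiniteField.frobeniusAlgHom Fq E ^ (r - 1)).toLinearMap +
    LinearMap.mulLeft Fq (algebraMap Fq[X] E X ^ (q - 1)) ∘ₗ
      (FiniteField.frobeniusAlgHom Fq E ^ r).toLinearMap

/-- The Drinfeld module action on an `𝔽_q[T]`-algebra. -/
def phi : Fq[X] →ₐ[Fq] Module.End Fq E := aeval (phiT r E)

variable {E}

theorem frobeniusAlgHom_pow_apply (n : ℕ) (x : E) :
    (FiniteField.frobeniusAlgHom Fq E ^ n) x = x ^ q ^ n := by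
  rw [AlgHom.coe_pow, FiniteField.coe_frobeniusAlgHom, pow_iterate]

theorem phiT_apply (x : E) : phiT (Fq := Fq) r E x = algebraMap Fq[X] E X * x + x ^ q ^ (r - 1) +
    algebraMap Fq[X] E X ^ (q - 1) * x ^ q ^ r := by
  simp only [phiT, LinearMap.add_apply, LinearMap.mulLeft_apply, LinearMap.comp_apply,
    AlgHom.toLinearMap_apply, frobeniusAlgHom_pow_apply]

theorem phi_X (x : E) : phi (Fq := Fq) r E X x = phiT (Fq := Fq) r E x := by
  simp [phi]

theorem phi_C (c : Fq) (x : E) : phi (Fq := Fq) r E (C c) x = c • x := by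
  simp [phi, Algebra.algebraMap_eq_smul_one]

theorem phi_mul (a b : Fq[X]) (x : E) : phi r E (a * b) x = phi r E a (phi r E b x) := by
  simp

theorem phi_add (a b : Fq[X]) (x : E) : phi r E (a + b) x = phi r E a x + phi r E b x := by
  simp

theorem phi_X_mul_add_C (a : Fq[X]) (c : Fq) (x : E) :
    phi r E (X * a + C c) x = phiT (Fq := Fq) r E (phi r E a x) + c • x := by
  rw [phi_add, phi_mul, phi_X, phi_C]

theorem induction_X_mul_add_C {M : Fq[X] → Prop} (a : Fq[X]) (h0 : M 0)
    (h : ∀ b c, M b → M (X * b + C c)) : M a := by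
  induction hn : a.natDegree using Nat.strong_induction_on generalizing a with
  | _ n ih =>
    rcases Nat.eq_zero_or_pos n with h1 | h1
    · rw [eq_C_of_natDegree_eq_zero (hn.trans h1)]
      simpa using h 0 (a.coeff 0) h0
    · rw [← X_mul_divX_add a]
      exact h _ _ (ih _ (by rw [natDegree_divX_eq_natDegree_tsub_one]; omega) _ rfl)

variable {E' : Type*} [CommRing E'] [Algebra Fq E'] [Algebra Fq[X] E'] [IsScalarTower Fq Fq[X] E']

theorem map_phi (f : E →ₐ[Fq[X]] E') (a : Fq[X]) (x : E) :
    f (phi r E a x) = phi r E' a (f x) := by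
  induction a using induction_X_mul_add_C with
  | h0 => simp
  | h b c ih =>
    rw [phi_X_mul_add_C, phi_X_mul_add_C, ← ih, map_add, phiT_apply, phiT_apply]
    have : f (c • x) = c • f x := map_smul (f.restrictScalars Fq) c x
    simp [this]

end Basic

section Pol

/-- The polynomial `φ_a(Y) ∈ 𝔽_q[T][Y]`. -/
def pol (a : Fq[X]) : Fq[X][X] := phi r Fq[X][X] a X

variable {E : Type*} [CommRing E] [Algebra Fq E] [Algebra Fq[X] E] [IsScalarTower Fq Fq[X] E]

theorem aeval_pol (a : Fq[X]) (x : E) : aeval x (pol r a) = phi r E a x := by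
  rw [pol, map_phi, aeval_X]

theorem map_pol (a : Fq[X]) : (pol r a).map (algebraMap Fq[X] E) = phi r E[X] a X := by
  have := map_phi r (mapAlgHom (Algebra.ofId Fq[X] E)) a X
  simpa [pol] using this

end Pol

section Degree

variable {E : Type*} [CommRing E] [IsDomain E] [Algebra Fq E] [Algebra Fq[X] E]
  [IsScalarTower Fq Fq[X] E]

theorem natDegree_phi {s : ℕ} (hs : 1 < s)
    (h : ∀ f : E[X], 0 < f.natDegree → (phiT (Fq := Fq) r E[X] f).natDegree = s * f.natDegree)
    {a : Fq[X]} (ha : a ≠ 0) {f : E[X]} (hf : 0 < f.natDegree) :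
    (phi r E[X] a f).natDegree = s ^ a.natDegree * f.natDegree := by
  induction a using induction_X_mul_add_C with
  | h0 => exact absurd rfl ha
  | h b c ih =>
    by_cases hb : b = 0
    · subst hb
      have hc : c ≠ 0 := by simpa using ha
      have hc' : algebraMap Fq E c ≠ 0 := by simpa using hc
      rw [mul_zero, zero_add, phi_C, natDegree_C, pow_zero, one_mul,
        ← IsScalarTower.algebraMap_smul E c f, natDegree_smul_of_smul_regular]
      exact IsSMulRegular.of_ne_zero hc'
    · have h1 := ih hb
      have h2 : 0 < (phi r E[X] b f).natDegree := by rw [h1]; positivity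
      have h3 := h _ h2
      have h4 : (c • f).natDegree < (phiT (Fq := Fq) r E[X] (phi r E[X] b f)).natDegree := by
        refine (natDegree_smul_le c f).trans_lt ?_
        rw [h3, h1]
        have : 0 < s ^ b.natDegree := by positivity
        nlinarith [Nat.mul_le_mul_right f.natDegree this]
      rw [phi_X_mul_add_C, natDegree_add_eq_left_of_natDegree_lt h4, h3, h1, natDegree_add_C,
        natDegree_X_mul hb]
      ring

theorem natDegree_phiT_of_ne_zero (hr : 2 ≤ r) (hT : algebraMap Fq[X] E X ≠ 0) (f : E[X])
    (hf : 0 < f.natDegree) :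
    (phiT (Fq := Fq) r E[X] f).natDegree = q ^ r * f.natDegree := by
  have hq : 1 < q := Fintype.one_lt_card
  have h1 : 1 < q ^ (r - 1) := Nat.one_lt_pow (by omega) hq
  have h2 : q ^ r = q * q ^ (r - 1) := by rw [← pow_succ']; congr; omega
  have hX : algebraMap Fq[X] E[X] X = C (algebraMap Fq[X] E X) := rfl
  have h3 : (C (algebraMap Fq[X] E X) ^ (q - 1) * f ^ q ^ r).natDegree =
      q ^ r * f.natDegree := by
    rw [← C_pow, natDegree_C_mul (pow_ne_zero _ hT), natDegree_pow]
  have h4 : (f ^ q ^ (r - 1)).natDegree < q ^ r * f.natDegree := by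
    rw [natDegree_pow, h2]
    have : 0 < q ^ (r - 1) * f.natDegree := by positivity
    nlinarith
  have h5 : (C (algebraMap Fq[X] E X) * f).natDegree < q ^ r * f.natDegree := by
    rw [natDegree_C_mul hT, h2]
    have : 1 < q * q ^ (r - 1) := by nlinarith
    nlinarith
  rw [phiT_apply, hX, natDegree_add_eq_right_of_natDegree_lt, h3]
  rw [h3]
  exact (natDegree_add_le _ _).trans_lt (max_lt h5 h4)

theorem natDegree_phiT_of_eq_zero (hT : algebraMap Fq[X] E X = 0) (f : E[X]) :
    (phiT (Fq := Fq) r E[X] f).natDegree = q ^ (r - 1) * f.natDegree := by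
  have hX : algebraMap Fq[X] E[X] X = 0 := by
    change C (algebraMap Fq[X] E X) = 0
    rw [hT, map_zero]
  have hq : q - 1 ≠ 0 := by have : 1 < q := Fintype.one_lt_card; omega
  rw [phiT_apply, hX, zero_mul, zero_add, zero_pow hq, zero_mul, add_zero, natDegree_pow]

theorem natDegree_map_pol_of_ne_zero (hr : 2 ≤ r) (hT : algebraMap Fq[X] E X ≠ 0) {a : Fq[X]}
    (ha : a ≠ 0) : ((pol r a).map (algebraMap Fq[X] E)).natDegree = q ^ (r * a.natDegree) := by
  rw [map_pol, natDegree_phi r (Nat.one_lt_pow (by omega) Fintype.one_lt_card)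
    (natDegree_phiT_of_ne_zero r hr hT) ha (by simp), natDegree_X, mul_one, pow_mul]

theorem natDegree_map_pol_of_eq_zero (hr : 2 ≤ r) (hT : algebraMap Fq[X] E X = 0) {a : Fq[X]}
    (ha : a ≠ 0) :
    ((pol r a).map (algebraMap Fq[X] E)).natDegree = q ^ ((r - 1) * a.natDegree) := by
  rw [map_pol, natDegree_phi r (Nat.one_lt_pow (by omega) Fintype.one_lt_card)
    (fun f _ ↦ natDegree_phiT_of_eq_zero r hT f) ha (by simp), natDegree_X, mul_one, pow_mul]

end Degree

theorem derivative_pol (hr : 2 ≤ r) (a : Fq[X]) : derivative (pol r a) = C a := by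
  have hq : ((q : ℕ) : Fq[X][X]) = 0 := by
    rw [← map_natCast (algebraMap Fq Fq[X][X]), FiniteField.cast_card_eq_zero, map_zero]
  have hpow : ∀ (n : ℕ) (f : Fq[X][X]), n ≠ 0 → derivative (f ^ q ^ n) = 0 := by
    intro n f hn
    rw [derivative_pow]
    simp [hq, hn]
  have hX : algebraMap Fq[X] Fq[X][X] X = C X := rfl
  rw [pol]
  induction a using induction_X_mul_add_C with
  | h0 => simp
  | h b c ih =>
    rw [phi_X_mul_add_C, phiT_apply, hX, ← C_pow]
    simp only [derivative_add, derivative_C_mul, derivative_smul, derivative_X, ih,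
      hpow r _ (by omega), hpow (r - 1) _ (by omega), mul_zero, add_zero, C_add, C_mul]
    rw [Algebra.smul_def, mul_one]
    rfl

theorem coeff_zero_pol (a : Fq[X]) : (pol r a).coeff 0 = 0 := by
  have := aeval_pol r a (0 : Fq[X])
  rw [map_zero] at this
  rwa [coe_aeval_eq_eval, ← coeff_zero_eq_eval_zero] at this

theorem coeff_one_pol (hr : 2 ≤ r) (a : Fq[X]) : (pol r a).coeff 1 = a := by
  have := congr_arg (coeff · 0) (derivative_pol r hr a)
  simpa [coeff_derivative] using this

section Torsion

variable {L : Type*} [Field L] [Algebra Fq L] [Algebra Fq[X] L] [IsScalarTower Fq Fq[X] L]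

theorem separable_map_pol [FaithfulSMul Fq[X] L] (hr : 2 ≤ r) {a : Fq[X]} (ha : a ≠ 0) :
    ((pol r a).map (algebraMap Fq[X] L)).Separable := by
  have ha' : algebraMap Fq[X] L a ≠ 0 := by simpa using ha
  refine ⟨0, C (algebraMap Fq[X] L a)⁻¹, ?_⟩
  rw [derivative_map, derivative_pol r hr, map_C, ← C_mul, inv_mul_cancel₀ ha']
  simp

theorem natDegree_map_pol [FaithfulSMul Fq[X] L] (hr : 2 ≤ r) {a : Fq[X]} (ha : a ≠ 0) :
    ((pol r a).map (algebraMap Fq[X] L)).natDegree = q ^ (r * a.natDegree) :=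
  natDegree_map_pol_of_ne_zero r hr (by simp) ha

theorem mem_rootSet_pol [FaithfulSMul Fq[X] L] (hr : 2 ≤ r) {a : Fq[X]} (ha : a ≠ 0) (x : L) :
    x ∈ ((pol r a).map (algebraMap Fq[X] L)).roots ↔ phi r L a x = 0 := by
  rw [mem_roots (separable_map_pol r hr ha).ne_zero, IsRoot, eval_map_algebraMap, aeval_pol]

end Torsion

theorem X_pow_card_sub_X_eq_prod (K : Type*) [Field K] [Fintype K] :
    (X ^ Fintype.card K - X : K[X]) = ∏ c : K, (X - C c) := by
  have h1 := FiniteField.X_pow_card_sub_X_natDegree_eq K (Fintype.one_lt_card (α := K))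
  have h2 : (X ^ Fintype.card K - X : K[X]).Monic :=
    monic_X_pow_sub (by rw [degree_X]; exact_mod_cast Fintype.one_lt_card)
  have h3 := prod_multiset_X_sub_C_of_monic_of_roots_card_eq h2 (by
    rw [FiniteField.roots_X_pow_card_sub_X, h1]; rfl)
  rw [FiniteField.roots_X_pow_card_sub_X] at h3
  exact h3.symm

section Valuation

variable {L : Type*} [Field L] [Algebra Fq L] [Algebra Fq[X] L] [IsScalarTower Fq Fq[X] L]
  {Γ₀ : Type*} [LinearOrderedCommGroupWithZero Γ₀] {v : Valuation L Γ₀}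

theorem valuation_algebraMap_eq_one (hv : ∀ a : Fq[X], v (algebraMap Fq[X] L a) ≤ 1) {c : Fq}
    (hc : c ≠ 0) : v (algebraMap Fq L c) = 1 := by
  have h : ∀ c : Fq, v (algebraMap Fq L c) ≤ 1 := fun c ↦ by
    rw [IsScalarTower.algebraMap_apply Fq Fq[X] L]; exact hv _
  refine le_antisymm (h c) ?_
  have h1 : v (algebraMap Fq L c) * v (algebraMap Fq L c⁻¹) = 1 := by
    rw [← map_mul, ← map_mul, mul_inv_cancel₀ hc, map_one, map_one]
  calc 1 = v (algebraMap Fq L c) * v (algebraMap Fq L c⁻¹) := h1.symm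
    _ ≤ v (algebraMap Fq L c) * 1 := by gcongr; exact h _
    _ = _ := mul_one _

theorem valuation_smul_le (hv : ∀ a : Fq[X], v (algebraMap Fq[X] L a) ≤ 1) (c : Fq) (x : L) :
    v (c • x) ≤ v x := by
  rw [Algebra.smul_def, map_mul, IsScalarTower.algebraMap_apply Fq Fq[X] L]
  exact mul_le_of_le_one_left' (hv _)

theorem valuation_phiT_le_one (hv : ∀ a : Fq[X], v (algebraMap Fq[X] L a) ≤ 1) {x : L}
    (hx : v x ≤ 1) : v (phiT (Fq := Fq) r L x) ≤ 1 := by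
  rw [phiT_apply]
  refine v.map_add_le (v.map_add_le ?_ ?_) ?_
  · rw [map_mul]; exact mul_le_one' (hv _) hx
  · rw [map_pow]; exact pow_le_one' hx _
  · rw [map_mul, map_pow, map_pow]; exact mul_le_one' (pow_le_one' (hv _) _) (pow_le_one' hx _)

theorem valuation_phi_le_one (hv : ∀ a : Fq[X], v (algebraMap Fq[X] L a) ≤ 1) (a : Fq[X]) {x : L}
    (hx : v x ≤ 1) : v (phi r L a x) ≤ 1 := by
  induction a using induction_X_mul_add_C with
  | h0 => simp
  | h b c ih =>
    rw [phi_X_mul_add_C]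
    exact v.map_add_le (valuation_phiT_le_one r hv ih) ((valuation_smul_le hv c x).trans hx)

theorem valuation_phi_sub_lt (hr : 2 ≤ r) (hv : ∀ a : Fq[X], v (algebraMap Fq[X] L a) ≤ 1)
    (a : Fq[X]) {x : L} (hx0 : x ≠ 0) (hx : v x < 1) :
    v (phi r L a x - algebraMap Fq[X] L a * x) < v x := by
  have hq : 1 < q := Fintype.one_lt_card
  have hpow : ∀ (n : ℕ) (y : L), n ≠ 0 → v y ≤ v x → v (y ^ q ^ n) < v x := by
    intro n y hn hy
    have hx0' : 0 < v x := by simpa [zero_lt_iff] using hx0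
    rw [map_pow]
    calc v y ^ q ^ n ≤ v x ^ q ^ n := pow_le_pow_left' hy _
      _ < v x ^ 1 := pow_lt_pow_right_of_lt_one₀ hx0' hx (Nat.one_lt_pow hn hq)
      _ = v x := pow_one _
  induction a using induction_X_mul_add_C with
  | h0 => simpa [zero_lt_iff] using hx0
  | h b c ih =>
    have h1 : v (phi r L b x) ≤ v x := by
      rw [← sub_add_cancel (phi r L b x) (algebraMap Fq[X] L b * x)]
      refine v.map_add_le ih.le ?_
      rw [map_mul]
      exact mul_le_of_le_one_left' (hv _)
    have h2 : phi r L (X * b + C c) x - algebraMap Fq[X] L (X * b + C c) * x =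
        algebraMap Fq[X] L X * (phi r L b x - algebraMap Fq[X] L b * x) +
        (phi r L b x) ^ q ^ (r - 1) +
        algebraMap Fq[X] L X ^ (q - 1) * (phi r L b x) ^ q ^ r := by
      rw [phi_X_mul_add_C, phiT_apply, map_add, map_mul, Algebra.smul_def,
        IsScalarTower.algebraMap_apply Fq Fq[X] L]
      simp only [Polynomial.algebraMap_eq]
      ring
    rw [h2]
    refine v.map_add_lt (v.map_add_lt ?_ (hpow _ _ (by omega) h1)) ?_
    · rw [map_mul]
      exact (mul_le_of_le_one_left' (hv _)).trans_lt ih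
    · rw [map_mul, map_pow]
      exact (mul_le_of_le_one_left' (pow_le_one' (hv _) _)).trans_lt (hpow _ _ (by omega) h1)

theorem valuation_phi_eq (hr : 2 ≤ r) (hv : ∀ a : Fq[X], v (algebraMap Fq[X] L a) ≤ 1)
    {a : Fq[X]} (ha : v (algebraMap Fq[X] L a) = 1) {x : L} (hx : v x < 1) :
    v (phi r L a x) = v x := by
  rcases eq_or_ne x 0 with rfl | hx0
  · simp
  have h := valuation_phi_sub_lt r hr hv a hx0 hx
  have h1 : v (algebraMap Fq[X] L a * x) = v x := by rw [map_mul, ha, one_mul]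
  rw [← h1] at h
  rw [← sub_add_cancel (phi r L a x) (algebraMap Fq[X] L a * x), v.map_add_eq_of_lt_right h, h1]

theorem phiT_eq_add_mul (hr : 1 ≤ r) (x : L) : phiT (Fq := Fq) r L x = algebraMap Fq[X] L X * x +
    x ^ q ^ (r - 1) * (1 + (algebraMap Fq[X] L X * x ^ q ^ (r - 1)) ^ (q - 1)) := by
  have h : x ^ q ^ (r - 1) * (x ^ q ^ (r - 1)) ^ (q - 1) = x ^ q ^ r := by
    rw [← pow_succ', ← pow_mul, Nat.sub_add_cancel Fintype.card_pos, ← pow_succ]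
    congr
    omega
  rw [phiT_apply, ← h, mul_pow]
  ring

theorem one_lt_card_pow (hr : 2 ≤ r) : 1 < q ^ (r - 1) :=
  Nat.one_lt_pow (by omega) Fintype.one_lt_card

theorem valuation_phiT_of_one_add (hr : 2 ≤ r) (hv : ∀ a : Fq[X], v (algebraMap Fq[X] L a) ≤ 1)
    {x : L} (hx : 1 < v x)
    (hb : 1 ≤ v (1 + (algebraMap Fq[X] L X * x ^ q ^ (r - 1)) ^ (q - 1))) :
    v (phiT (Fq := Fq) r L x) =
      v x ^ q ^ (r - 1) * v (1 + (algebraMap Fq[X] L X * x ^ q ^ (r - 1)) ^ (q - 1)) := by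
  rw [phiT_eq_add_mul r (by omega), v.map_add_eq_of_lt_right, map_mul, map_pow]
  rw [map_mul, map_mul, map_pow]
  calc v (algebraMap Fq[X] L X) * v x ≤ v x := mul_le_of_le_one_left' (hv _)
    _ = v x ^ 1 := (pow_one _).symm
    _ < v x ^ q ^ (r - 1) := pow_lt_pow_right₀ hx (one_lt_card_pow r hr)
    _ ≤ _ := le_mul_of_one_le_right' hb

theorem valuation_phiT_of_lt (hr : 2 ≤ r) (hv : ∀ a : Fq[X], v (algebraMap Fq[X] L a) ≤ 1) {x : L}
    (hx : 1 < v x) (hb : v (algebraMap Fq[X] L X) * v x ^ q ^ (r - 1) < 1) :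
    v (phiT (Fq := Fq) r L x) = v x ^ q ^ (r - 1) := by
  have hq : 1 < q := Fintype.one_lt_card
  have h1 : v (1 + (algebraMap Fq[X] L X * x ^ q ^ (r - 1)) ^ (q - 1)) = 1 := by
    apply v.map_one_add_of_lt
    rw [map_pow, map_mul, map_pow]
    exact pow_lt_one₀ zero_le hb (by omega)
  rw [valuation_phiT_of_one_add r hr hv hx h1.ge, h1, mul_one]

theorem lt_valuation_phiT (hr : 2 ≤ r) (hv : ∀ a : Fq[X], v (algebraMap Fq[X] L a) ≤ 1) {x : L}
    (hx : 1 < v x) (hb : 1 ≤ v (1 + (algebraMap Fq[X] L X * x ^ q ^ (r - 1)) ^ (q - 1))) :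
    v x < v (phiT (Fq := Fq) r L x) := by
  rw [valuation_phiT_of_one_add r hr hv hx hb]
  refine lt_of_lt_of_le ?_ (le_mul_of_one_le_right' hb)
  nth_rewrite 1 [← pow_one (v x)]
  exact pow_lt_pow_right₀ hx (one_lt_card_pow r hr)

/-- In a finite stable subspace, points `x` outside the unit ball satisfy `v(T) v(x) ^ s ≤ 1`. -/
theorem valuation_mul_pow_le_one (hr : 2 ≤ r) (hv : ∀ a : Fq[X], v (algebraMap Fq[X] L a) ≤ 1)
    (W : Submodule Fq L) [Finite W] (hW : ∀ x ∈ W, phiT (Fq := Fq) r L x ∈ W) {x : L} (hx : x ∈ W)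
    (hx1 : 1 < v x) : v (algebraMap Fq[X] L X) * v x ^ q ^ (r - 1) ≤ 1 := by
  have hq : 1 < q := Fintype.one_lt_card
  obtain ⟨m, hm, hmax⟩ := Set.exists_max_image (W : Set L) v (Set.toFinite _) ⟨x, hx⟩
  by_contra! hb
  have hb' : 1 < v (algebraMap Fq[X] L X) * v m ^ q ^ (r - 1) :=
    hb.trans_le (by gcongr; exact hmax x hx)
  have h1 : 1 < v ((algebraMap Fq[X] L X * m ^ q ^ (r - 1)) ^ (q - 1)) := by
    rw [map_pow, map_mul, map_pow]
    exact one_lt_pow₀ hb' (by omega)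
  have h2 : 1 ≤ v (1 + (algebraMap Fq[X] L X * m ^ q ^ (r - 1)) ^ (q - 1)) := by
    rw [v.map_add_eq_of_lt_right (by rwa [map_one])]
    exact h1.le
  exact (hmax _ (hW m hm)).not_gt (lt_valuation_phiT r hr hv (hx1.trans_le (hmax x hx)) h2)

theorem exists_level (hr : 2 ≤ r) (hv : ∀ a : Fq[X], v (algebraMap Fq[X] L a) ≤ 1)
    (W : Submodule Fq L) [Finite W] (hW : ∀ x ∈ W, phiT (Fq := Fq) r L x ∈ W) {x : L} (hx : x ∈ W)
    (hx1 : 1 < v x) :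
    ∃ k : ℕ, v (algebraMap Fq[X] L X) * v x ^ (q ^ (r - 1)) ^ (k + 1) = 1 := by
  by_contra hbad
  let B : Set L := {x | x ∈ W ∧ 1 < v x ∧
    ¬ ∃ k : ℕ, v (algebraMap Fq[X] L X) * v x ^ (q ^ (r - 1)) ^ (k + 1) = 1}
  have hB : B.Finite := (Set.toFinite (W : Set L)).subset fun y hy ↦ hy.1
  obtain ⟨m, ⟨hmW, hm1, hm⟩, hmax⟩ := Set.exists_max_image B v hB ⟨x, hx, hx1, hbad⟩
  rcases (valuation_mul_pow_le_one r hr hv W hW hmW hm1).lt_or_eq with h | h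
  · have h1 := valuation_phiT_of_lt r hr hv hm1 h
    have h2 : v m < v (phiT (Fq := Fq) r L m) := by
      rw [h1]
      nth_rewrite 1 [← pow_one (v m)]
      exact pow_lt_pow_right₀ hm1 (one_lt_card_pow r hr)
    have h3 : phiT (Fq := Fq) r L m ∉ B := fun h ↦ (hmax _ h).not_gt h2
    apply h3
    refine ⟨hW m hmW, hm1.trans h2, ?_⟩
    rintro ⟨k, hk⟩
    refine hm ⟨k + 1, ?_⟩
    rwa [h1, ← pow_mul, ← pow_succ'] at hk
  · exact hm ⟨0, by simpa using h⟩

theorem mul_pow_lt_one_of_level {a t : Γ₀} {s i k : ℕ} (hs : 1 < s) (ht : 1 < t)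
    (h : a * t ^ s ^ k = 1) (hik : i < k) : a * t ^ s ^ i < 1 := by
  have ha : 0 < a := by
    rw [zero_lt_iff]
    rintro rfl
    simp at h
  rw [← h]
  exact mul_lt_mul_of_pos_left (pow_lt_pow_right₀ ht (Nat.pow_lt_pow_right hs hik)) ha

theorem valuation_phi_of_level (hr : 2 ≤ r) (hv : ∀ a : Fq[X], v (algebraMap Fq[X] L a) ≤ 1)
    {x : L} (hx1 : 1 < v x) {k : ℕ}
    (hk : v (algebraMap Fq[X] L X) * v x ^ (q ^ (r - 1)) ^ k = 1) {a : Fq[X]} (ha0 : a ≠ 0)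
    (ha : a.natDegree < k) : v (phi r L a x) = v x ^ (q ^ (r - 1)) ^ a.natDegree := by
  induction a using induction_X_mul_add_C with
  | h0 => exact absurd rfl ha0
  | h b c ih =>
    by_cases hb : b = 0
    · subst hb
      have hc : c ≠ 0 := by simpa using ha0
      rw [mul_zero, zero_add, phi_C, natDegree_C, pow_zero, pow_one, Algebra.smul_def, map_mul,
        valuation_algebraMap_eq_one hv hc, one_mul]
    · rw [natDegree_add_C, natDegree_X_mul hb] at ha ⊢
      have h1 := ih hb (by omega)
      have h2 : 1 < v (phi r L b x) := by
        rw [h1]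
        exact one_lt_pow₀ hx1 (by have := one_lt_card_pow (Fq := Fq) r hr; positivity)
      have h3 := valuation_phiT_of_lt r hr hv h2 (by
        rw [h1, ← pow_mul, ← pow_succ]
        exact mul_pow_lt_one_of_level (one_lt_card_pow r hr) hx1 hk ha)
      rw [h1, ← pow_mul, ← pow_succ] at h3
      have h4 : v x < v x ^ (q ^ (r - 1)) ^ (b.natDegree + 1) := by
        nth_rewrite 1 [← pow_one (v x)]
        exact pow_lt_pow_right₀ hx1 (Nat.one_lt_pow (by omega) (one_lt_card_pow r hr))
      rw [phi_X_mul_add_C, v.map_add_eq_of_lt_left, h3]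
      rw [h3]
      exact (valuation_smul_le hv c x).trans_lt h4

/-- Two points of level one with the same valuation are congruent up to a scalar. -/
theorem exists_smul_sub_lt (hr : 2 ≤ r) (hv : ∀ a : Fq[X], v (algebraMap Fq[X] L a) ≤ 1)
    (W : Submodule Fq L) [Finite W] (hW : ∀ x ∈ W, phiT (Fq := Fq) r L x ∈ W) {y z : L}
    (hy : y ∈ W) (hz : z ∈ W) (hy1 : 1 < v y) (hz1 : 1 < v z)
    (hby : v (algebraMap Fq[X] L X) * v y ^ q ^ (r - 1) = 1)
    (hbz : v (algebraMap Fq[X] L X) * v z ^ q ^ (r - 1) = 1) :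
    ∃ c : Fq, v (y - c • z) < v z := by
  have hq : 1 < q := Fintype.one_lt_card
  have key : ∀ w ∈ W, 1 < v w → v (algebraMap Fq[X] L X) * v w ^ q ^ (r - 1) = 1 →
      v (1 + (algebraMap Fq[X] L X * w ^ q ^ (r - 1)) ^ (q - 1)) < 1 := by
    intro w hw hw1 hb
    by_contra! h
    have h1 := lt_valuation_phiT r hr hv hw1 h
    have h2 := valuation_mul_pow_le_one r hr hv W hW (hW w hw) (hw1.trans h1)
    rw [← hb] at h2
    refine h2.not_gt (mul_lt_mul_of_pos_left (pow_lt_pow_left₀ h1 zero_le ?_) ?_)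
    · have := one_lt_card_pow (Fq := Fq) r hr; omega
    · rw [zero_lt_iff]; intro h; simp [h] at hb
  have hT : algebraMap Fq[X] L X ≠ 0 := by rintro h; simp [h] at hby
  have hz0 : z ≠ 0 := by rintro rfl; simp at hz1
  set s := q ^ (r - 1) with hs
  set uy := algebraMap Fq[X] L X * y ^ s with huy
  set uz := algebraMap Fq[X] L X * z ^ s with huz
  have huz0 : uz ≠ 0 := mul_ne_zero hT (pow_ne_zero _ hz0)
  have hvuy : v uy = 1 := by rw [huy, map_mul, map_pow, hby]
  have hvuz : v uz = 1 := by rw [huz, map_mul, map_pow, hbz]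
  set t := uy / uz with ht
  have hvt : v t = 1 := by rw [ht, map_div₀, hvuy, hvuz, div_one]
  have h1 : v (t ^ (q - 1) - 1) < 1 := by
    have h2 : t ^ (q - 1) - 1 = ((1 + uy ^ (q - 1)) - (1 + uz ^ (q - 1))) / uz ^ (q - 1) := by
      rw [ht, div_pow]
      field_simp
      ring
    rw [h2, map_div₀, map_pow v uz, hvuz, one_pow, div_one]
    exact v.map_sub_lt (key y hy hy1 hby) (key z hz hz1 hbz)
  have h2 : v (t ^ q - t) < 1 := by
    have : t ^ q - t = t * (t ^ (q - 1) - 1) := by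
      rw [mul_sub, ← pow_succ', Nat.sub_add_cancel hq.le, mul_one]
    rwa [this, map_mul, hvt, one_mul]
  obtain ⟨c, hc⟩ : ∃ c : Fq, v (t - algebraMap Fq L c) < 1 := by
    by_contra! h
    have h3 : t ^ q - t = ∏ c : Fq, (t - algebraMap Fq L c) := by
      have := congr_arg (aeval t) (X_pow_card_sub_X_eq_prod Fq)
      simpa [aeval_prod] using this
    rw [h3, map_prod] at h2
    exact h2.not_ge (Finset.one_le_prod'' h)
  refine ⟨c, ?_⟩
  have h3 : t - algebraMap Fq L c = ((y - c • z) / z) ^ s := by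
    have h4 : t = (y / z) ^ s := by
      rw [ht, huy, huz, mul_div_mul_left _ _ hT, div_pow]
    have h5 : algebraMap Fq L c = algebraMap Fq L c ^ s := by
      rw [← map_pow, hs, FiniteField.pow_card_pow]
    have h6 : (y - c • z) / z = y / z - algebraMap Fq L c := by
      rw [Algebra.smul_def]
      field_simp
    have h7 := map_sub (FiniteField.frobeniusAlgHom Fq L ^ (r - 1)) (y / z) (algebraMap Fq L c)
    rw [frobeniusAlgHom_pow_apply, frobeniusAlgHom_pow_apply, frobeniusAlgHom_pow_apply, ← hs,
      ← h5, ← h4] at h7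
    rw [h6, h7]
  rw [h3, map_pow] at hc
  have h4 : v ((y - c • z) / z) < 1 := by
    by_contra! h
    exact hc.not_ge (one_le_pow₀ h)
  rwa [map_div₀, div_lt_one₀ (by rw [zero_lt_iff]; simpa using hz0)] at h4

end Valuation

section Ball

variable {L : Type*} [Field L] [Algebra Fq L] [Algebra Fq[X] L] [IsScalarTower Fq Fq[X] L]
  {Γ₀ : Type*} [LinearOrderedCommGroupWithZero Γ₀] {v : Valuation L Γ₀}

theorem residue_eq_zero_iff_valuation_lt_one (x : v.valuationSubring) :
    IsLocalRing.residue v.valuationSubring x = 0 ↔ v x < 1 := by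
  rw [IsLocalRing.residue_eq_zero_iff, IsLocalRing.mem_maximalIdeal, mem_nonunits_iff]
  have h := (Valuation.valuationSubring.integers v).isUnit_iff_valuation_eq_one (x := x)
  rw [h]
  have h2 : v x ≤ 1 := x.2
  exact ⟨fun h ↦ lt_of_le_of_ne h2 h, fun h ↦ h.ne⟩

variable (v) in
/-- The reduction map of `𝔽_q[T]` at a place where `T` is integral. -/
def reduction (hv : ∀ a : Fq[X], v (algebraMap Fq[X] L a) ≤ 1) :
    Fq[X] →+* IsLocalRing.ResidueField v.valuationSubring :=
  (IsLocalRing.residue v.valuationSubring).comp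
    ((algebraMap Fq[X] L).codRestrict v.valuationSubring.toSubring hv)

theorem reduction_eq_zero_iff (hv : ∀ a : Fq[X], v (algebraMap Fq[X] L a) ≤ 1) (a : Fq[X]) :
    reduction v hv a = 0 ↔ v (algebraMap Fq[X] L a) < 1 :=
  residue_eq_zero_iff_valuation_lt_one _

theorem eval₂_reduction (hv : ∀ a : Fq[X], v (algebraMap Fq[X] L a) ≤ 1) (f : Fq[X][X])
    (x : v.valuationSubring) (hx : aeval (x : L) f = 0) :
    f.eval₂ (reduction v hv) (IsLocalRing.residue _ x) = 0 := by
  have h : f.eval₂ ((algebraMap Fq[X] L).codRestrict v.valuationSubring.toSubring hv) x = 0 := by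
    have h1 := hom_eval₂ f ((algebraMap Fq[X] L).codRestrict v.valuationSubring.toSubring hv)
      v.valuationSubring.subtype x
    have h2 : v.valuationSubring.subtype.comp
      ((algebraMap Fq[X] L).codRestrict v.valuationSubring.toSubring hv) = algebraMap Fq[X] L := rfl
    rw [h2] at h1
    apply v.valuationSubring.subtype_injective
    rw [h1, map_zero]
    exact hx
  rw [reduction, ← hom_eval₂, h, map_zero]

theorem natDegree_map_reduction (hr : 2 ≤ r) (hv : ∀ a : Fq[X], v (algebraMap Fq[X] L a) ≤ 1)
    (hX : v (algebraMap Fq[X] L X) < 1) {a : Fq[X]} (ha : a ≠ 0) :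
    ((pol r a).map (reduction v hv)).natDegree = q ^ ((r - 1) * a.natDegree) := by
  let : Algebra Fq[X] (IsLocalRing.ResidueField v.valuationSubring) := (reduction v hv).toAlgebra
  let : Algebra Fq (IsLocalRing.ResidueField v.valuationSubring) :=
    ((reduction v hv).comp C).toAlgebra
  have : IsScalarTower Fq Fq[X] (IsLocalRing.ResidueField v.valuationSubring) :=
    IsScalarTower.of_algebraMap_eq fun _ ↦ rfl
  exact natDegree_map_pol_of_eq_zero r hr ((reduction_eq_zero_iff hv X).2 hX) ha

theorem finite_ker_phi [FaithfulSMul Fq[X] L] (hr : 2 ≤ r) {a : Fq[X]} (ha : a ≠ 0) :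
    Finite (LinearMap.ker (phi r L a)) := by
  classical
  refine Set.Finite.subset (((pol r a).map (algebraMap Fq[X] L)).roots.toFinset.finite_toSet) ?_
  intro x hx
  simpa [mem_rootSet_pol r hr ha, -mem_roots'] using hx

theorem card_unit_ball_le [FaithfulSMul Fq[X] L] (hr : 2 ≤ r)
    (hv : ∀ a : Fq[X], v (algebraMap Fq[X] L a) ≤ 1)
    (hX : v (algebraMap Fq[X] L X) < 1) {a : Fq[X]} (ha : v (algebraMap Fq[X] L a) = 1) :
    {x : L | phi r L a x = 0 ∧ v x ≤ 1}.ncard ≤ q ^ ((r - 1) * a.natDegree) := by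
  classical
  have ha0 : a ≠ 0 := by rintro rfl; simp at ha
  have hdeg := natDegree_map_reduction r hr hv hX ha0
  have hne : (pol r a).map (reduction v hv) ≠ 0 := by
    intro h
    rw [h, natDegree_zero] at hdeg
    exact absurd hdeg.symm (pow_ne_zero _ Fintype.card_ne_zero)
  let g : L → IsLocalRing.ResidueField v.valuationSubring := fun x ↦
    if h : v x ≤ 1 then IsLocalRing.residue v.valuationSubring ⟨x, h⟩ else 0
  refine (Set.ncard_le_ncard_of_injOn g
    (t := (((pol r a).map (reduction v hv)).roots.toFinset : Set _)) ?_ ?_).trans ?_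
  · rintro x ⟨hx, hx1⟩
    simp only [g, dif_pos hx1, Finset.mem_coe, Multiset.mem_toFinset]
    rw [mem_roots hne, IsRoot, eval_map]
    exact eval₂_reduction hv _ _ (by rw [aeval_pol]; exact hx)
  · rintro x ⟨hx, hx1⟩ y ⟨hy, hy1⟩ hxy
    simp only [g, dif_pos hx1, dif_pos hy1] at hxy
    rw [← sub_eq_zero, ← map_sub, residue_eq_zero_iff_valuation_lt_one] at hxy
    have h1 : v (x - y) < 1 := hxy
    have h2 := valuation_phi_eq r hr hv ha h1
    rw [map_sub, hx, hy, sub_zero, map_zero, eq_comm, map_eq_zero, sub_eq_zero] at h2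
    exact h2
  · rw [Set.ncard_coe_finset, ← hdeg]
    exact (Multiset.toFinset_card_le _).trans (card_roots' _)

theorem eq_of_level {a t u : Γ₀} {n : ℕ} (hn : n ≠ 0) (h : a * t ^ n = 1) (h' : a * u ^ n = 1) :
    t = u := by
  have ha : a ≠ 0 := by rintro rfl; simp at h
  have h1 := mul_left_cancel₀ ha (h.trans h'.symm)
  exact (pow_left_inj₀ zero_le zero_le hn).1 h1

/-- A finite stable subspace is generated, up to its unit ball, by a shortest point outside the
unit ball. -/
theorem exists_generator (hr : 2 ≤ r) (hv : ∀ a : Fq[X], v (algebraMap Fq[X] L a) ≤ 1)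
    (W : Submodule Fq L) [Finite W] (hW : ∀ (a : Fq[X]), ∀ x ∈ W, phi r L a x ∈ W)
    (hne : ∃ x ∈ W, 1 < v x) :
    ∃ x ∈ W, 1 < v x ∧ ∃ k : ℕ, v (algebraMap Fq[X] L X) * v x ^ (q ^ (r - 1)) ^ k = 1 ∧
      ∀ y ∈ W, ∃ a : Fq[X], a ∈ degreeLT Fq k ∧ v (y - phi r L a x) ≤ 1 := by
  have hs := one_lt_card_pow (Fq := Fq) r hr
  have hW' : ∀ x ∈ W, phiT (Fq := Fq) r L x ∈ W := fun x hx ↦ by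
    rw [← phi_X]; exact hW _ _ hx
  obtain ⟨x1, hx1, hx1'⟩ := hne
  obtain ⟨x, ⟨hxW, hx1⟩, hmin⟩ := Set.exists_min_image {x | x ∈ W ∧ 1 < v x} v
    ((Set.toFinite (W : Set L)).subset fun y hy ↦ hy.1) ⟨x1, hx1, hx1'⟩
  obtain ⟨k, hk⟩ := exists_level r hr hv W hW' hxW hx1
  refine ⟨x, hxW, hx1, k + 1, hk, ?_⟩
  by_contra! hbad
  obtain ⟨y, ⟨hyW, hy⟩, hymin⟩ := Set.exists_min_image
    {y | y ∈ W ∧ ∀ a : Fq[X], a ∈ degreeLT Fq (k + 1) → 1 < v (y - phi r L a x)} v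
    ((Set.toFinite (W : Set L)).subset fun y hy ↦ hy.1) hbad
  have hy1 : 1 < v y := by simpa using hy 0 (zero_mem (degreeLT Fq (k + 1)))
  obtain ⟨j, hj⟩ := exists_level r hr hv W hW' hyW hy1
  have hjk : j ≤ k := by
    by_contra! h
    refine (mul_pow_lt_one_of_level hs hy1 hj (Nat.succ_lt_succ h)).not_ge ?_
    rw [← hk]
    gcongr
    exact hmin y ⟨hyW, hy1⟩
  have hXpow : ∀ n : ℕ, (X ^ n : Fq[X]) ≠ 0 := fun n ↦ pow_ne_zero _ X_ne_zero
  set z := phi r L (X ^ (k - j) : Fq[X]) x with hz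
  have hzW : z ∈ W := hW _ _ hxW
  have hvz : v z = v x ^ (q ^ (r - 1)) ^ (k - j) := by
    rw [hz, valuation_phi_of_level r hr hv hx1 hk (hXpow _) (by rw [natDegree_X_pow]; omega),
      natDegree_X_pow]
  have hjz : v (algebraMap Fq[X] L X) * v z ^ (q ^ (r - 1)) ^ (j + 1) = 1 := by
    rw [hvz, ← pow_mul, ← pow_add, show k - j + (j + 1) = k + 1 by omega, hk]
  have hvyz : v y = v z := eq_of_level (by positivity) hj hjz
  have lev : ∀ u ∈ W, v u = v y → v (phi r L (X ^ j : Fq[X]) u) = v y ^ (q ^ (r - 1)) ^ j := by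
    intro u hu huy
    rw [valuation_phi_of_level r hr hv (huy ▸ hy1) (huy ▸ hj) (hXpow _) (by simp),
      natDegree_X_pow, huy]
  have lev1 : ∀ u ∈ W, v u = v y → 1 < v (phi r L (X ^ j : Fq[X]) u) ∧
      v (algebraMap Fq[X] L X) * v (phi r L (X ^ j : Fq[X]) u) ^ q ^ (r - 1) = 1 := by
    intro u hu huy
    rw [lev u hu huy, ← pow_mul (v y), ← pow_succ (q ^ (r - 1))]
    exact ⟨one_lt_pow₀ hy1 (by positivity), hj⟩
  obtain ⟨c, hc⟩ := exists_smul_sub_lt r hr hv W hW' (hW (X ^ j) _ hyW) (hW (X ^ j) _ hzW)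
    (lev1 y hyW rfl).1 (lev1 z hzW hvyz.symm).1 (lev1 y hyW rfl).2 (lev1 z hzW hvyz.symm).2
  have hwW : y - c • z ∈ W := W.sub_mem hyW (W.smul_mem _ hzW)
  have hwle : v (y - c • z) ≤ v y :=
    v.map_sub_le le_rfl (hvyz ▸ valuation_smul_le hv c z)
  have hwge : v y ≤ v (y - c • z) := by
    refine hymin _ ⟨hwW, fun a ha ↦ ?_⟩
    have h1 : y - c • z - phi r L a x = y - phi r L (C c * X ^ (k - j) + a) x := by
      rw [phi_add, phi_mul, phi_C, hz]
      ring
    rw [h1]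
    refine hy _ (add_mem ?_ ha)
    rw [mem_degreeLT]
    refine (degree_C_mul_X_pow_le _ _).trans_lt ?_
    exact_mod_cast (by omega : k - j < k + 1)
  have h2 := lev _ hwW (le_antisymm hwle hwge)
  rw [map_sub, map_smul] at h2
  rw [h2, lev z hzW hvyz.symm] at hc
  exact hc.false

theorem card_degreeLT (n : ℕ) : Nat.card (degreeLT Fq n) = q ^ n := by
  rw [Nat.card_congr (degreeLTEquiv Fq n).toEquiv, Nat.card_fun]
  simp

/-- At a place above `T`, the unit ball of `φ[a]` has the size predicted by the Newton polygon, and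
`v(T)` is highly divisible. -/
theorem card_unit_ball_and_valuation [FaithfulSMul Fq[X] L] (hr : 2 ≤ r)
    (hv : ∀ a : Fq[X], v (algebraMap Fq[X] L a) ≤ 1)
    (hX : v (algebraMap Fq[X] L X) < 1) {a : Fq[X]} (ha : v (algebraMap Fq[X] L a) = 1)
    (hd : 0 < a.natDegree)
    (hcard : Nat.card (LinearMap.ker (phi r L a)) = q ^ (r * a.natDegree)) :
    {x : L | phi r L a x = 0 ∧ v x ≤ 1}.ncard = q ^ ((r - 1) * a.natDegree) ∧
    ∃ x : L, v (algebraMap Fq[X] L X) * v x ^ q ^ ((r - 1) * a.natDegree) = 1 := by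
  have hq : 1 < q := Fintype.one_lt_card
  have ha0 : a ≠ 0 := by rintro rfl; simp at ha
  have := finite_ker_phi (L := L) r hr ha0
  have hle := card_unit_ball_le r hr hv hX ha
  set d := a.natDegree
  have hexp : r * d = (r - 1) * d + d := by
    rw [← Nat.succ_mul]; congr 1; omega
  set W := LinearMap.ker (phi r L a) with hWdef
  have hW : ∀ (b : Fq[X]), ∀ x ∈ W, phi r L b x ∈ W := by
    intro b x hx
    rw [hWdef, LinearMap.mem_ker] at hx ⊢
    rw [← phi_mul, mul_comm, phi_mul, hx, map_zero]
  have hBfin : {x : L | phi r L a x = 0 ∧ v x ≤ 1}.Finite :=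
    (Set.toFinite (W : Set L)).subset fun y hy ↦ hy.1
  have hne : ∃ x ∈ W, 1 < v x := by
    by_contra! h
    have h1 : (W : Set L) ⊆ {x : L | phi r L a x = 0 ∧ v x ≤ 1} := fun x hx ↦ ⟨hx, h x hx⟩
    have h2 := Set.ncard_le_ncard h1 hBfin
    have h3 : (W : Set L).ncard = q ^ (r * d) := hcard
    rw [h3] at h2
    have h4 := (Nat.pow_le_pow_iff_right hq).1 (h2.trans hle)
    omega
  obtain ⟨x, hxW, hx1, k, hk, hgen⟩ := exists_generator r hr hv W hW hne
  have hkd : k ≤ d := by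
    by_contra! h
    have h1 := valuation_phi_of_level r hr hv hx1 hk ha0 h
    rw [LinearMap.mem_ker.1 hxW, map_zero, eq_comm] at h1
    exact (pow_ne_zero _ (zero_lt_one.trans hx1).ne') h1
  choose! b hb hb' using hgen
  have hcard' : q ^ (r * d) ≤ {x : L | phi r L a x = 0 ∧ v x ≤ 1}.ncard * q ^ k := by
    have := hBfin.to_subtype
    have : Finite (degreeLT Fq k) := Finite.of_equiv _ (degreeLTEquiv Fq k).toEquiv.symm
    have h1 := Nat.card_le_card_of_injective
      (fun y : W ↦ ((⟨y - phi r L (b y) x, W.sub_mem y.2 (hW _ _ hxW), hb' y y.2⟩,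
        ⟨b y, hb y y.2⟩) : {x : L | phi r L a x = 0 ∧ v x ≤ 1} × degreeLT Fq k)) (by
        intro y z hyz
        simp only [Prod.mk.injEq, Subtype.mk.injEq] at hyz
        rw [hyz.2, sub_left_inj] at hyz
        exact Subtype.ext hyz.1)
    rwa [hcard, Nat.card_prod, card_degreeLT] at h1
  have hkd' : k = d := by
    have h1 := hcard'.trans (Nat.mul_le_mul_right _ hle)
    rw [← pow_add] at h1
    have h2 := (Nat.pow_le_pow_iff_right hq).1 h1
    omega
  subst hkd'
  refine ⟨le_antisymm hle ?_, x, ?_⟩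
  · rw [hexp, pow_add] at hcard'
    exact Nat.le_of_mul_le_mul_right hcard' (by positivity)
  · rwa [pow_mul]

end Ball

section Good

variable {L : Type*} [Field L] [Algebra Fq L] [Algebra Fq[X] L] [IsScalarTower Fq Fq[X] L]
  {Γ₀ : Type*} [LinearOrderedCommGroupWithZero Γ₀] {v : Valuation L Γ₀}

theorem valuation_phi_of_one_lt (hr : 2 ≤ r) (hv : ∀ a : Fq[X], v (algebraMap Fq[X] L a) ≤ 1)
    (hX : v (algebraMap Fq[X] L X) = 1) {x : L} (hx : 1 < v x) {a : Fq[X]} (ha : a ≠ 0) :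
    v x ≤ v (phi r L a x) := by
  have hq : 1 < q := Fintype.one_lt_card
  induction a using induction_X_mul_add_C with
  | h0 => exact absurd rfl ha
  | h b c ih =>
    by_cases hb : b = 0
    · subst hb
      have hc : c ≠ 0 := by simpa using ha
      rw [mul_zero, zero_add, phi_C, Algebra.smul_def, map_mul, valuation_algebraMap_eq_one hv hc,
        one_mul]
    · have h1 := ih hb
      have h2 : 1 < v (phi r L b x) := hx.trans_le h1
      set y := phi r L b x
      have h3 : v ((algebraMap Fq[X] L X * y ^ q ^ (r - 1)) ^ (q - 1)) =
          v y ^ (q ^ (r - 1) * (q - 1)) := by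
        rw [map_pow, map_mul, hX, one_mul, map_pow, ← pow_mul]
      have h4 : 1 < v ((algebraMap Fq[X] L X * y ^ q ^ (r - 1)) ^ (q - 1)) := by
        rw [h3]
        exact one_lt_pow₀ h2 (mul_ne_zero (by positivity) (by omega))
      have h5 : 1 ≤ v (1 + (algebraMap Fq[X] L X * y ^ q ^ (r - 1)) ^ (q - 1)) := by
        rw [v.map_add_eq_of_lt_right (by rwa [map_one])]
        exact h4.le
      have h6 := lt_valuation_phiT r hr hv h2 h5
      have h7 : v (c • x) < v (phiT (Fq := Fq) r L y) :=
        ((valuation_smul_le hv c x).trans h1).trans_lt h6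
      rw [phi_X_mul_add_C, v.map_add_eq_of_lt_left h7]
      exact h1.trans h6.le

theorem natDegree_map_reduction_of_one (hr : 2 ≤ r)
    (hv : ∀ a : Fq[X], v (algebraMap Fq[X] L a) ≤ 1)
    (hX : v (algebraMap Fq[X] L X) = 1) {a : Fq[X]} (ha : a ≠ 0) :
    ((pol r a).map (reduction v hv)).natDegree = q ^ (r * a.natDegree) := by
  let _ : Algebra Fq[X] (IsLocalRing.ResidueField v.valuationSubring) := (reduction v hv).toAlgebra
  let _ : Algebra Fq (IsLocalRing.ResidueField v.valuationSubring) :=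
    ((reduction v hv).comp C).toAlgebra
  have _ : IsScalarTower Fq Fq[X] (IsLocalRing.ResidueField v.valuationSubring) :=
    IsScalarTower.of_algebraMap_eq fun _ ↦ rfl
  refine natDegree_map_pol_of_ne_zero r hr (fun h ↦ ?_) ha
  exact hX.not_lt ((reduction_eq_zero_iff hv X).1 h)

/-- At a place above `l`, the reduction of `φ[l]` is not injective. -/
theorem exists_mem_ker_valuation_lt_one [FaithfulSMul Fq[X] L] (hr : 2 ≤ r)
    (hv : ∀ a : Fq[X], v (algebraMap Fq[X] L a) ≤ 1)
    (hX : v (algebraMap Fq[X] L X) = 1) {l : Fq[X]} (hl0 : l ≠ 0)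
    (hl : v (algebraMap Fq[X] L l) < 1)
    (hcard : Nat.card (LinearMap.ker (phi r L l)) = q ^ (r * l.natDegree)) :
    ∃ x : L, phi r L l x = 0 ∧ x ≠ 0 ∧ v x < 1 := by
  classical
  by_contra! hbad
  have hint : ∀ x : L, phi r L l x = 0 → v x ≤ 1 := by
    intro x hx
    by_contra! h
    have h1 := valuation_phi_of_one_lt r hr hv hX h hl0
    rw [hx, map_zero] at h1
    exact (h1.trans_lt (zero_lt_one.trans h)).false
  have _ := finite_ker_phi (L := L) r hr hl0
  set f := (pol r l).map (reduction v hv) with hf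
  have hdeg : f.natDegree = _ := natDegree_map_reduction_of_one r hr hv hX hl0
  have hne : f ≠ 0 := by
    intro h
    rw [h, natDegree_zero] at hdeg
    exact absurd hdeg.symm (pow_ne_zero _ Fintype.card_ne_zero)
  let g : LinearMap.ker (phi r L l) → f.roots.toFinset := fun x ↦
    ⟨IsLocalRing.residue v.valuationSubring ⟨x, hint x x.2⟩, by
      rw [Multiset.mem_toFinset, mem_roots hne, IsRoot, eval_map]
      exact eval₂_reduction hv _ _ (by rw [aeval_pol]; exact x.2)⟩
  have hg : Function.Injective g := by
    intro x y hxy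
    have h1 := Subtype.ext_iff.1 hxy
    simp only [g] at h1
    rw [← sub_eq_zero, ← map_sub, residue_eq_zero_iff_valuation_lt_one] at h1
    by_contra hne
    refine (hbad (x - y : L) (x - y).2 ?_).not_gt h1
    rw [sub_ne_zero]
    exact fun h ↦ hne (Subtype.ext h)
  have h1 := Nat.card_le_card_of_injective g hg
  rw [hcard, Nat.card_eq_fintype_card, Fintype.card_coe, ← hdeg] at h1
  have h2 : f.roots.Nodup := by
    rw [← Multiset.toFinset_card_eq_card_iff_nodup]
    exact le_antisymm (Multiset.toFinset_card_le _) ((card_roots' f).trans h1)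
  have h3 : 1 < f.roots.count 0 := by
    rw [count_roots, one_lt_rootMultiplicity_iff_isRoot hne]
    constructor
    · rw [IsRoot, ← coeff_zero_eq_eval_zero, hf, coeff_map, coeff_zero_pol, map_zero]
    · rw [hf, derivative_map, derivative_pol r hr, map_C, (reduction_eq_zero_iff hv l).2 hl]
      simp
  exact (Multiset.nodup_iff_count_le_one.1 h2 0).not_gt h3

/-- The Newton polygon of `φ_l` at a place above `l`: its part of positive slope is a segment. -/
theorem exists_slope [FaithfulSMul Fq[X] L] (hr : 2 ≤ r)
    (hv : ∀ a : Fq[X], v (algebraMap Fq[X] L a) ≤ 1)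
    (hX : v (algebraMap Fq[X] L X) = 1) {l : Fq[X]} (hl0 : l ≠ 0)
    (hl : ∀ a : Fq[X], v (algebraMap Fq[X] L a) < 1 ↔ l ∣ a) :
    ∃ N : ℕ, N ≠ 0 ∧ ∃ c : L, v c = 1 ∧ ∀ x : L, phi r L l x = 0 → x ≠ 0 → v x < 1 →
      v x ^ N = v (algebraMap Fq[X] L l) ∧
      v (algebraMap Fq[X] L l + c * x ^ N) < v (algebraMap Fq[X] L l) := by
  classical
  have hl' : algebraMap Fq[X] L l ≠ 0 := by simpa using hl0
  have hdeg := natDegree_map_reduction_of_one r hr hv hX hl0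
  have hex : ∃ n, ¬ l ∣ (pol r l).coeff n := by
    by_contra! h
    have h1 : (pol r l).map (reduction v hv) = 0 := by
      ext n
      rw [coeff_map, coeff_zero, reduction_eq_zero_iff, hl]
      exact h n
    rw [h1, natDegree_zero] at hdeg
    exact absurd hdeg.symm (pow_ne_zero _ Fintype.card_ne_zero)
  set n := Nat.find hex with hn
  have hn1 : ¬ l ∣ (pol r l).coeff n := Nat.find_spec hex
  have hn2 : ∀ i < n, l ∣ (pol r l).coeff i := fun i hi ↦ not_not.1 (Nat.find_min hex hi)
  have hn3 : 2 ≤ n := by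
    by_contra! h
    interval_cases hh : n
    · simp [coeff_zero_pol] at hn1
    · simp [coeff_one_pol r hr] at hn1
  have hc : v (algebraMap Fq[X] L ((pol r l).coeff n)) = 1 :=
    le_antisymm (hv _) (not_lt.1 fun h ↦ hn1 ((hl _).1 h))
  refine ⟨n - 1, by omega, algebraMap Fq[X] L ((pol r l).coeff n), hc, fun x hx hx0 hx1 ↦ ?_⟩
  set c := algebraMap Fq[X] L ((pol r l).coeff n)
  have hvx : 0 < v x := by simpa [zero_lt_iff] using hx0
  have hvl : 0 < v (algebraMap Fq[X] L l) := by rw [zero_lt_iff]; simpa using hl'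
  set M := max (v (algebraMap Fq[X] L l * x)) (v (x ^ n)) with hM
  have hM0 : 0 < M := lt_max_of_lt_left (by rw [map_mul]; exact mul_pos hvl hvx)
  have hpow : ∀ {i j : ℕ}, i < j → v (x ^ j) < v (x ^ i) := fun h ↦ by
    rw [map_pow, map_pow]; exact pow_lt_pow_right_of_lt_one₀ hvx hx1 h
  have hterm : ∀ i, i ≠ 1 → i ≠ n → v (algebraMap Fq[X] L ((pol r l).coeff i) * x ^ i) < M := by
    intro i hi1 hin
    rcases lt_or_gt_of_ne hin with h | h
    · rcases Nat.eq_zero_or_pos i with rfl | hi0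
      · simpa [coeff_zero_pol] using hM0
      obtain ⟨b, hb⟩ := hn2 i h
      refine lt_of_lt_of_le ?_ (le_max_left _ _)
      rw [hb, map_mul, map_mul, map_mul, mul_assoc, map_mul]
      refine mul_lt_mul_of_pos_left ?_ hvl
      refine (mul_le_of_le_one_left' (hv _)).trans_lt ?_
      simpa using hpow (show 1 < i by omega)
    · refine lt_of_lt_of_le ?_ (le_max_right _ _)
      rw [map_mul]
      exact (mul_le_of_le_one_left' (hv _)).trans_lt (hpow h)
  have hsum : v (algebraMap Fq[X] L l * x + c * x ^ n) < M := by
    have h1 : algebraMap Fq[X] L l * x + c * x ^ n =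
        - ∑ i ∈ (Finset.range ((pol r l).natDegree + 1) \ {1, n}),
          algebraMap Fq[X] L ((pol r l).coeff i) * x ^ i := by
      have h2 := aeval_pol r l x
      rw [hx, aeval_eq_sum_range] at h2
      have h3 : ({1, n} : Finset ℕ) ⊆ Finset.range ((pol r l).natDegree + 1) := by
        have h5 : n ≤ (pol r l).natDegree := le_natDegree_of_ne_zero (by
          intro h; rw [h] at hn1; exact hn1 (dvd_zero _))
        intro i hi
        simp only [Finset.mem_insert, Finset.mem_singleton] at hi
        rw [Finset.mem_range]
        omega
      rw [← Finset.sum_sdiff h3, Finset.sum_pair (by omega)] at h2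
      simp only [Algebra.smul_def, coeff_one_pol r hr, pow_one] at h2
      linear_combination h2
    rw [h1, Valuation.map_neg]
    refine v.map_sum_lt hM0.ne' fun i hi ↦ ?_
    simp only [Finset.mem_sdiff, Finset.mem_insert, Finset.mem_singleton, not_or] at hi
    exact hterm i hi.2.1 hi.2.2
  have hcx : v (c * x ^ n) = v (x ^ n) := by rw [map_mul, hc, one_mul]
  have heq : v (algebraMap Fq[X] L l * x) = v (x ^ n) := by
    by_contra h
    rw [v.map_add_of_distinct_val (by rwa [hcx]), hcx] at hsum
    exact hsum.false
  have hxn : x ^ n = x ^ (n - 1) * x := by rw [← pow_succ]; congr; omega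
  constructor
  · rw [hxn, map_mul, map_mul, map_pow] at heq
    exact (mul_right_cancel₀ hvx.ne' heq).symm
  · rw [hM, ← heq, max_self, hxn, ← mul_assoc, ← add_mul, map_mul, map_mul] at hsum
    exact lt_of_mul_lt_mul_right hsum hvx.le

theorem card_small_torsion_le [FaithfulSMul Fq[X] L] {l : Fq[X]}
    (hl0 : l ≠ 0) {N : ℕ} {c : L} (hN : N ≠ 0) (hc : v c = 1)
    (h : ∀ x : L, phi r L l x = 0 → x ≠ 0 → v x < 1 →
      v x ^ N = v (algebraMap Fq[X] L l) ∧
      v (algebraMap Fq[X] L l + c * x ^ N) < v (algebraMap Fq[X] L l)) :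
    {x : L | phi r L l x = 0 ∧ x ≠ 0 ∧ v x < 1}.ncard ≤ N := by
  classical
  rcases Set.eq_empty_or_nonempty {x : L | phi r L l x = 0 ∧ x ≠ 0 ∧ v x < 1} with h0 | ⟨x₀, hx₀⟩
  · rw [h0]; simp
  have hvl : 0 < v (algebraMap Fq[X] L l) := by rw [zero_lt_iff]; simpa using hl0
  have hval : ∀ x ∈ {x : L | phi r L l x = 0 ∧ x ≠ 0 ∧ v x < 1}, v x = v x₀ := by
    rintro x ⟨h1, h2, h3⟩
    have := (h x h1 h2 h3).1.trans (h x₀ hx₀.1 hx₀.2.1 hx₀.2.2).1.symm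
    exact (pow_left_inj₀ zero_le zero_le hN).1 this
  have hx₀0 := hx₀.2.1
  have hvx₀ : v x₀ ≠ 0 := by simpa using hx₀0
  let g : L → IsLocalRing.ResidueField v.valuationSubring := fun x ↦
    if h : v (x / x₀) ≤ 1 then IsLocalRing.residue v.valuationSubring ⟨x / x₀, h⟩ else 0
  have hle : ∀ x ∈ {x : L | phi r L l x = 0 ∧ x ≠ 0 ∧ v x < 1}, v (x / x₀) ≤ 1 := by
    intro x hx
    rw [map_div₀, hval x hx, div_self hvx₀]
  refine (Set.ncard_le_ncard_of_injOn g
    (t := ((nthRoots N (1 : IsLocalRing.ResidueField v.valuationSubring)).toFinset : Set _))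
    ?_ ?_).trans ?_
  · intro x hx
    simp only [g, dif_pos (hle x hx), Finset.mem_coe, Multiset.mem_toFinset]
    rw [mem_nthRoots (Nat.pos_of_ne_zero hN), ← sub_eq_zero, ← map_pow,
      ← map_one (IsLocalRing.residue v.valuationSubring), ← map_sub,
      residue_eq_zero_iff_valuation_lt_one]
    have h1 : v ((x / x₀) ^ N - 1) < 1 := by
      have h2 : (x / x₀) ^ N - 1 = ((algebraMap Fq[X] L l + c * x ^ N) -
          (algebraMap Fq[X] L l + c * x₀ ^ N)) / (c * x₀ ^ N) := by
        have hc0 : c ≠ 0 := by rintro rfl; simp at hc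
        rw [div_pow]
        field_simp
        ring
      rw [h2, map_div₀, map_mul, hc, one_mul, map_pow, (h x₀ hx₀.1 hx₀.2.1 hx₀.2.2).1,
        div_lt_one₀ hvl]
      exact v.map_sub_lt (h x hx.1 hx.2.1 hx.2.2).2 (h x₀ hx₀.1 hx₀.2.1 hx₀.2.2).2
    exact h1
  · intro x hx y hy hxy
    simp only [g, dif_pos (hle x hx), dif_pos (hle y hy)] at hxy
    rw [← sub_eq_zero, ← map_sub, residue_eq_zero_iff_valuation_lt_one] at hxy
    have h1 : v (x / x₀ - y / x₀) < 1 := hxy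
    rw [← sub_div, map_div₀, div_lt_one₀ (zero_lt_iff.2 hvx₀)] at h1
    by_contra hne
    have h2 := hval (x - y) ⟨by rw [map_sub, hx.1, hy.1, sub_zero], sub_ne_zero.2 hne,
      h1.trans hx₀.2.2⟩
    exact (h2 ▸ h1).false
  · rw [Set.ncard_coe_finset]
    exact (Multiset.toFinset_card_le _).trans (card_nthRoots _ _)

end Good

section Transitive

variable {F L : Type*} [Field F] [Field L] [Algebra F L] [FiniteDimensional F L]
  [Algebra Fq L] [Algebra Fq[X] L] [IsScalarTower Fq Fq[X] L] [FaithfulSMul Fq[X] L]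
  {v : Valuation L (WithZero (Multiplicative ℤ))}

open WithZero in
/-- Inertia above `l` acts transitively on the nonzero points of `φ[l]` in the open unit ball. -/
theorem exists_inertia_transitive (hr : 2 ≤ r)
    (hv : ∀ a : Fq[X], v (algebraMap Fq[X] L a) ≤ 1)
    (hX : v (algebraMap Fq[X] L X) = 1) {l : Fq[X]} (hl0 : l ≠ 0)
    (hl : ∀ a : Fq[X], v (algebraMap Fq[X] L a) < 1 ↔ l ∣ a)
    (I : Subgroup (L ≃ₐ[F] L)) (hIv : ∀ σ ∈ I, ∀ x, v (σ x) = v x)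
    (hIphi : ∀ σ ∈ I, ∀ x, phi r L l (σ x) = σ (phi r L l x))
    (hvl : v (algebraMap Fq[X] L l) = exp (-(Nat.card I : ℤ)))
    (hfix : ∀ y : L, y ≠ 0 → (∀ σ ∈ I, σ y = y) → ∃ n : ℤ, v y = exp (n * Nat.card I))
    {x₀ x : L} (hx₀ : phi r L l x₀ = 0) (hx₀0 : x₀ ≠ 0) (hx₀1 : v x₀ < 1)
    (hx : phi r L l x = 0) (hx0 : x ≠ 0) (hx1 : v x < 1) : ∃ σ ∈ I, σ x₀ = x := by
  classical
  obtain ⟨N, hN, c, hc, h⟩ := exists_slope r hr hv hX hl0 hl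
  have hcard := card_small_torsion_le r hl0 hN hc h
  set S := {x : L | phi r L l x = 0 ∧ x ≠ 0 ∧ v x < 1} with hS
  have hSfin : S.Finite := by
    have _ := finite_ker_phi (L := L) r hr hl0
    exact (Set.toFinite (LinearMap.ker (phi r L l) : Set L)).subset fun y hy ↦ hy.1
  set O := MulAction.orbit I x₀ with hO
  have hOS : O ⊆ S := by
    rintro _ ⟨σ, rfl⟩
    change (σ : L ≃ₐ[F] L) x₀ ∈ S
    refine ⟨by rw [hIphi _ σ.2, hx₀, map_zero], by simpa using hx₀0, by rwa [hIv _ σ.2]⟩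
  have hOfin : O.Finite := hSfin.subset hOS
  set s := hOfin.toFinset with hs
  have hsval : ∀ y ∈ s, v y = v x₀ := by
    intro y hy
    obtain ⟨σ, rfl⟩ := hOfin.mem_toFinset.1 hy
    exact hIv _ σ.2 _
  have hs0 : 0 < s.card := Finset.card_pos.2 ⟨x₀, hOfin.mem_toFinset.2 (MulAction.mem_orbit_self x₀)⟩
  obtain ⟨n, hn⟩ := hfix (∏ y ∈ s, y)
    (Finset.prod_ne_zero_iff.2 fun y hy ↦ (hOS (hOfin.mem_toFinset.1 hy)).2.1) (by
      intro σ hσ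
      rw [map_prod]
      refine Finset.prod_bij (fun y _ ↦ σ y) ?_ ?_ ?_ ?_
      · intro y hy
        rw [hOfin.mem_toFinset] at hy ⊢
        exact (MulAction.mem_orbit_of_mem_orbit (⟨σ, hσ⟩ : I) hy)
      · intro y _ z _ hyz
        exact σ.injective hyz
      · intro y hy
        rw [hOfin.mem_toFinset] at hy
        refine ⟨σ.symm y, ?_, σ.apply_symm_apply y⟩
        rw [hOfin.mem_toFinset]
        exact (MulAction.mem_orbit_of_mem_orbit (⟨σ, hσ⟩ : I)⁻¹ hy)
      · intro y _
        rfl)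
  have hcardI : 0 < Nat.card I := Nat.card_pos
  have hdvd : N ∣ s.card := by
    rw [map_prod, Finset.prod_congr rfl hsval, Finset.prod_const] at hn
    have h1 : (v x₀ ^ s.card) ^ N = (v (algebraMap Fq[X] L l)) ^ s.card := by
      rw [← (h x₀ hx₀ hx₀0 hx₀1).1, ← pow_mul, ← pow_mul, mul_comm]
    rw [hn, hvl, ← exp_nsmul, ← exp_nsmul, exp_inj] at h1
    simp only [nsmul_eq_mul] at h1
    have h2 : (s.card : ℤ) = N * (-n) := by
      have h3 : (Nat.card I : ℤ) ≠ 0 := by exact_mod_cast hcardI.ne'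
      apply mul_right_cancel₀ h3
      linear_combination h1
    exact_mod_cast Dvd.intro _ h2.symm
  have hle := Nat.le_of_dvd hs0 hdvd
  have hSO : O = S := by
    refine Set.eq_of_subset_of_ncard_le hOS ?_ hSfin
    rw [Set.ncard_eq_toFinset_card _ hOfin]
    exact hcard.trans hle
  obtain ⟨σ, hσ⟩ : x ∈ O := hSO ▸ ⟨hx, hx0, hx1⟩
  exact ⟨σ, σ.2, hσ⟩

end Transitive

section Torsion

variable (L : Type*) [Field L] [Algebra Fq L] [Algebra Fq[X] L] [IsScalarTower Fq Fq[X] L]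
  (l : Fq[X])

theorem phi_comm (a b : Fq[X]) (x : L) : phi r L a (phi r L b x) = phi r L b (phi r L a x) := by
  rw [← phi_mul, mul_comm, phi_mul]

/-- The action of `𝔽_q[T]` on the torsion `φ[l]`. -/
def torsionEnd : Fq[X] →ₐ[Fq] Module.End Fq (LinearMap.ker (phi r L l)) :=
  aeval (LinearMap.restrict (p := LinearMap.ker (phi r L l)) (phiT r L)
    fun x (hx : phi r L l x = 0) ↦ LinearMap.mem_ker.2 <| by
      rw [← phi_X, phi_comm, hx, map_zero])

variable {L l}

theorem coe_torsionEnd (a : Fq[X]) (x : LinearMap.ker (phi r L l)) :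
    (torsionEnd r L l a x : L) = phi r L a x := by
  induction a using induction_X_mul_add_C with
  | h0 => simp
  | h b c ih =>
    rw [phi_X_mul_add_C, ← ih, map_add, map_mul]
    simp only [torsionEnd, aeval_X, aeval_C, LinearMap.add_apply, Module.End.mul_apply,
      Submodule.coe_add, Module.algebraMap_end_apply, Submodule.coe_smul]
    rfl

theorem torsionEnd_eq_zero (a : Fq[X]) (ha : a ∈ Ideal.span {l}) : torsionEnd r L l a = 0 := by
  obtain ⟨b, rfl⟩ := Ideal.mem_span_singleton.1 ha
  refine LinearMap.ext fun x ↦ Subtype.ext ?_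
  have hx : phi r L l x = 0 := x.2
  rw [coe_torsionEnd, mul_comm, phi_mul, hx, map_zero]
  rfl

variable (L l) in
/-- The action of `𝔽_q[T] / (l)` on `φ[l]`. -/
def torsionHom : Fq[X] ⧸ Ideal.span {l} →+* Module.End Fq (LinearMap.ker (phi r L l)) :=
  Ideal.Quotient.lift (Ideal.span {l}) (torsionEnd r L l).toRingHom (torsionEnd_eq_zero r)

/-- The `𝔽_q[T] / (l)`-module structure on `φ[l]`. -/
instance torsionModule : Module (Fq[X] ⧸ Ideal.span {l}) (LinearMap.ker (phi r L l)) :=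
  Module.compHom _ (torsionHom r L l)

theorem coe_mk_smul (a : Fq[X]) (x : LinearMap.ker (phi r L l)) :
    ((Ideal.Quotient.mk (Ideal.span {l}) a • x : LinearMap.ker (phi r L l)) : L) = phi r L a x :=
  coe_torsionEnd r a x

variable {F : Type*} [Field F] [Algebra F L] [Algebra Fq[X] F] [IsScalarTower Fq[X] F L]

theorem algEquiv_phi (σ : L ≃ₐ[F] L) (a : Fq[X]) (x : L) :
    σ (phi r L a x) = phi r L a (σ x) :=
  map_phi r ((σ : L →ₐ[F] L).restrictScalars Fq[X]) a x

theorem algEquiv_mem_ker (σ : L ≃ₐ[F] L) {x : L} (hx : x ∈ LinearMap.ker (phi r L l)) :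
    σ x ∈ LinearMap.ker (phi r L l) := by
  rw [LinearMap.mem_ker] at hx ⊢
  rw [← algEquiv_phi, hx, map_zero]

variable (l F) in
/-- The Galois representation on `φ[l]`. -/
def torsionRep : (L ≃ₐ[F] L) →*
    (LinearMap.ker (phi r L l) ≃ₗ[Fq[X] ⧸ Ideal.span {l}] LinearMap.ker (phi r L l)) where
  toFun σ :=
    { toFun := fun x ↦ ⟨σ x, algEquiv_mem_ker r σ x.2⟩
      invFun := fun x ↦ ⟨σ.symm x, algEquiv_mem_ker r σ.symm x.2⟩
      left_inv := fun x ↦ Subtype.ext (σ.symm_apply_apply x)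
      right_inv := fun x ↦ Subtype.ext (σ.apply_symm_apply x)
      map_add' := fun x y ↦ Subtype.ext (map_add σ (x : L) y)
      map_smul' := fun c x ↦ by
        obtain ⟨a, rfl⟩ := Ideal.Quotient.mk_surjective c
        refine Subtype.ext ((congrArg σ (coe_mk_smul r a x)).trans ?_)
        rw [algEquiv_phi, RingHom.id_apply, coe_mk_smul] }
  map_one' := rfl
  map_mul' _ _ := rfl

theorem card_quotient (hl : l ≠ 0) :
    Nat.card (Fq[X] ⧸ Ideal.span {l}) = q ^ l.natDegree := by
  have : Module.Finite Fq (Fq[X] ⧸ Ideal.span {l}) := by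
    exact (AdjoinRoot.powerBasis hl).finite
  rw [Module.natCard_eq_pow_finrank (K := Fq), finrank_quotient_span_eq_natDegree,
    Nat.card_eq_fintype_card]

attribute [local instance] Ideal.Quotient.field

theorem finrank_torsion [(Ideal.span {l}).IsMaximal] [FaithfulSMul Fq[X] L] (hr : 2 ≤ r)
    (hl : l ≠ 0) (hd : 0 < l.natDegree)
    (hcard : Nat.card (LinearMap.ker (phi r L l)) = q ^ (r * l.natDegree)) :
    Module.finrank (Fq[X] ⧸ Ideal.span {l}) (LinearMap.ker (phi r L l)) = r := by
  have hfin := finite_ker_phi (L := L) r hr hl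
  have : Module.Finite (Fq[X] ⧸ Ideal.span {l}) (LinearMap.ker (phi r L l)) :=
    Module.Finite.of_finite
  have hq : 1 < q := Fintype.one_lt_card
  rw [Module.natCard_eq_pow_finrank (K := Fq[X] ⧸ Ideal.span {l}), card_quotient hl, ← pow_mul]
    at hcard
  have := Nat.pow_right_injective hq hcard
  rw [mul_comm] at this
  exact Nat.eq_of_mul_eq_mul_right hd this

end Torsion

section Image

variable {L F : Type*} [Field L] [Algebra Fq L] [Algebra Fq[X] L] [IsScalarTower Fq Fq[X] L]
  {l : Fq[X]} [Field F] [Algebra F L] [Algebra Fq[X] F] [IsScalarTower Fq[X] F L]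

attribute [local instance] Ideal.Quotient.field

open WithZero IsDedekindDomain in
theorem exists_place [IsFractionRing Fq[X] F] [FiniteDimensional F L] [IsGalois F L]
    {a : Fq[X]} (ha : Irreducible a) :
    ∃ (v : Valuation L (WithZero (Multiplicative ℤ))) (I : Subgroup (L ≃ₐ[F] L)),
      (∀ b : Fq[X], v (algebraMap Fq[X] L b) ≤ 1) ∧
      (∀ b : Fq[X], v (algebraMap Fq[X] L b) < 1 ↔ a ∣ b) ∧
      (∀ σ ∈ I, ∀ x, v (σ x) = v x) ∧
      (∀ σ ∈ I, ∀ x, v x ≤ 1 → v (σ x - x) < 1) ∧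
      v (algebraMap Fq[X] L a) = exp (-(Nat.card I : ℤ)) ∧
      (∀ y : L, y ≠ 0 → (∀ σ ∈ I, σ y = y) → ∃ n : ℤ, v y = exp (n * Nat.card I)) := by
  let p : HeightOneSpectrum Fq[X] :=
    { asIdeal := Ideal.span {a}
      isPrime := (Ideal.span_singleton_prime ha.ne_zero).2 ha.prime
      ne_bot := by simpa using ha.ne_zero }
  have : Finite (Fq[X] ⧸ p.asIdeal) := by
    have := card_quotient (l := a) ha.ne_zero
    refine Nat.finite_of_card_ne_zero (this.trans_ne ?_)
    exact pow_ne_zero _ Fintype.card_ne_zero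
  obtain ⟨v, I, h1, h2, h3, h4, h5, h6⟩ := exists_valuation_inertia (F := F) (L := L) p
  refine ⟨v, I, h1, fun b ↦ (h2 b).trans Ideal.mem_span_singleton, h3, h4, ?_, h6⟩
  rw [IsScalarTower.algebraMap_apply Fq[X] F L, h5, HeightOneSpectrum.valuation_of_algebraMap,
    p.intValuation_singleton ha.ne_zero rfl, ← exp_nsmul]
  simp

open WithZero in
theorem exists_transvection_mem_range [(Ideal.span {l}).IsMaximal]
    [IsFractionRing Fq[X] F] [FiniteDimensional F L] [IsGalois F L] [FaithfulSMul Fq[X] L]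
    (hr : 2 ≤ r) (hl : l ≠ 0) (hlX : ¬ X ∣ l) (hd : 0 < l.natDegree)
    (hcard : Nat.card (LinearMap.ker (phi r L l)) = q ^ (r * l.natDegree))
    (hfaith : Function.Injective (torsionRep r (L := L) l F)) :
    ∃ f : Module.Dual (Fq[X] ⧸ Ideal.span {l}) (LinearMap.ker (phi r L l)), f ≠ 0 ∧
      ∀ (w) (h : f w = 0), LinearEquiv.transvection h ∈ (torsionRep r (L := L) l F).range := by
  obtain ⟨v, I, hv, hvX, hIv, hIres, hXval, -⟩ :=
    exists_place (F := F) (L := L) (irreducible_X (R := Fq))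
  have hX : v (algebraMap Fq[X] L X) < 1 := (hvX X).2 dvd_rfl
  have hl1 : v (algebraMap Fq[X] L l) = 1 :=
    le_antisymm (hv l) (not_lt.1 fun h ↦ hlX ((hvX l).1 h))
  obtain ⟨hball, x₁, hx₁⟩ := card_unit_ball_and_valuation r hr hv hX hl1 hd hcard
  have hfin := finite_ker_phi (L := L) r hr hl
  have : Module.Finite (Fq[X] ⧸ Ideal.span {l}) (LinearMap.ker (phi r L l)) :=
    Module.Finite.of_finite
  have hk := card_quotient (l := l) hl
  have hq : 1 < q := Fintype.one_lt_card
  have hkfin : Finite (Fq[X] ⧸ Ideal.span {l}) :=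
    Nat.finite_of_card_ne_zero (hk.trans_ne (pow_ne_zero _ (by omega)))
  have hrank := finrank_torsion (L := L) r hr hl hd hcard
  let H : Submodule (Fq[X] ⧸ Ideal.span {l}) (LinearMap.ker (phi r L l)) :=
    { carrier := {x | v (x : L) ≤ 1}
      add_mem' := fun hx hy ↦ v.map_add_le hx hy
      zero_mem' := by simp
      smul_mem' := fun c x hx ↦ by
        obtain ⟨a, rfl⟩ := Ideal.Quotient.mk_surjective c
        rw [Set.mem_ofPred_eq, coe_mk_smul]
        exact valuation_phi_le_one r hv a hx }
  have hHcard : Nat.card H = q ^ ((r - 1) * l.natDegree) := by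
    rw [← hball, ← Nat.card_coe_set_eq]
    exact Nat.card_congr
      { toFun := fun x ↦ ⟨x.1, x.1.2, x.2⟩
        invFun := fun x ↦ ⟨⟨x.1, x.2.1⟩, x.2.2⟩
        left_inv := fun _ ↦ rfl
        right_inv := fun _ ↦ rfl }
  have hHrank : Module.finrank (Fq[X] ⧸ Ideal.span {l}) H = r - 1 := by
    rw [Module.natCard_eq_pow_finrank (K := Fq[X] ⧸ Ideal.span {l}), hk, ← pow_mul, mul_comm]
      at hHcard
    exact Nat.eq_of_mul_eq_mul_right hd (Nat.pow_right_injective hq hHcard)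
  have hHtop : H < ⊤ := by
    refine lt_top_iff_ne_top.2 fun h ↦ ?_
    rw [h, finrank_top] at hHrank
    omega
  obtain ⟨f, hf, hHf⟩ := Submodule.exists_le_ker_of_lt_top H hHtop
  have hker : H = LinearMap.ker f := by
    refine Submodule.eq_of_le_of_finrank_le hHf ?_
    have h1 : Module.finrank (Fq[X] ⧸ Ideal.span {l}) (LinearMap.ker f) <
        Module.finrank (Fq[X] ⧸ Ideal.span {l}) (LinearMap.ker (phi r L l)) :=
      Submodule.finrank_lt (by rwa [Ne, LinearMap.ker_eq_top])
    omega
  refine ⟨f, hf, fun w h ↦ ?_⟩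
  refine transvection_mem_range (torsionRep r l F) hfaith hf I (fun σ hσ x hx ↦ ?_) ?_ h
  · have hxH : v (x : L) ≤ 1 := by
      have : x ∈ H := hker ▸ LinearMap.mem_ker.2 hx
      exact this
    have h1 := hIres σ hσ x hxH
    have h2 := valuation_phi_eq r hr hv hl1 h1
    have h3 : phi r L l (σ x) = 0 := algEquiv_mem_ker r σ x.2
    have h4 : phi r L l x = 0 := x.2
    rw [map_sub, h3, h4, sub_zero, map_zero, eq_comm, map_eq_zero, sub_eq_zero] at h2
    exact Subtype.ext h2
  · rw [← hker, hHcard]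
    have hx₁0 : v x₁ ≠ 0 := by
      intro h
      rw [h, zero_pow (pow_ne_zero _ (by omega)), mul_zero] at hx₁
      exact zero_ne_one hx₁
    rw [hXval, ← exp_log hx₁0, ← exp_nsmul, ← exp_add, exp_eq_one] at hx₁
    rw [← Int.natCast_dvd_natCast]
    refine ⟨log (v x₁), ?_⟩
    rw [nsmul_eq_mul] at hx₁
    linarith

theorem exists_det_torsionRep_eq [(Ideal.span {l}).IsMaximal]
    [IsFractionRing Fq[X] F] [FiniteDimensional F L] [IsGalois F L] [FaithfulSMul Fq[X] L]
    (hr : 2 ≤ r) (hl : Irreducible l) (hlX : ¬ l ∣ X)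
    (hcard : Nat.card (LinearMap.ker (phi r L l)) = q ^ (r * l.natDegree))
    {u : Fq[X] ⧸ Ideal.span {l}} (hu : u ≠ 0) :
    ∃ σ : L ≃ₐ[F] L, LinearMap.det (torsionRep r l F σ : LinearMap.ker (phi r L l) →ₗ[
      Fq[X] ⧸ Ideal.span {l}] LinearMap.ker (phi r L l)) = u := by
  obtain ⟨v, I, hv, hvl, hIv, hIres, hval, hfix⟩ := exists_place (F := F) (L := L) hl
  have hX : v (algebraMap Fq[X] L X) = 1 :=
    le_antisymm (hv X) (not_lt.1 fun h ↦ hlX ((hvl X).1 h))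
  have hl0 := hl.ne_zero
  have hl1 : v (algebraMap Fq[X] L l) < 1 := (hvl l).2 dvd_rfl
  have hfin := finite_ker_phi (L := L) r hr hl0
  have hkfin : Finite (Fq[X] ⧸ Ideal.span {l}) :=
    Nat.finite_of_card_ne_zero ((card_quotient hl0).trans_ne (pow_ne_zero _ Fintype.card_ne_zero))
  obtain ⟨x₀, hx₀, hx₀0, hx₀1⟩ := exists_mem_ker_valuation_lt_one r hr hv hX hl0 hl1 hcard
  have htrans : ∀ x : L, phi r L l x = 0 → x ≠ 0 → v x < 1 → ∃ σ ∈ I, σ x₀ = x :=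
    fun x h1 h2 h3 ↦ exists_inertia_transitive r hr hv hX hl0 hvl I hIv
      (fun σ _ x ↦ (algEquiv_phi r σ l x).symm) hval hfix hx₀ hx₀0 hx₀1 h1 h2 h3
  have hint : ∀ x : L, phi r L l x = 0 → v x ≤ 1 := by
    intro x hx
    by_contra! h
    have h1 := valuation_phi_of_one_lt r hr hv hX h hl0
    rw [hx, map_zero] at h1
    exact (zero_lt_one.trans h).not_ge h1
  have hdiv : ∀ x : L, phi r L l x = 0 → v x < 1 → v (x / x₀) ≤ 1 := by
    intro x hx hx1
    rcases eq_or_ne x 0 with rfl | hx0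
    · simp
    obtain ⟨σ, hσ, rfl⟩ := htrans x hx hx0 hx1
    rw [map_div₀, hIv σ hσ, div_self ((Valuation.ne_zero_iff v).2 hx₀0)]
  have hphi : ∀ (a : Fq[X]) {x : L}, v x < 1 → v (phi r L a x) < 1 := by
    intro a x hx
    rcases eq_or_ne x 0 with rfl | hx0
    · simp
    rw [← sub_add_cancel (phi r L a x) (algebraMap Fq[X] L a * x)]
    refine v.map_add_lt ((valuation_phi_sub_lt r hr hv a hx0 hx).trans hx) ?_
    rw [map_mul]
    exact (mul_le_of_le_one_left' (hv a)).trans_lt hx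
  let W : Submodule (Fq[X] ⧸ Ideal.span {l}) (LinearMap.ker (phi r L l)) :=
    { carrier := {x | v (x : L) < 1}
      add_mem' := fun hx hy ↦ v.map_add_lt hx hy
      zero_mem' := by simp
      smul_mem' := fun c x hx ↦ by
        obtain ⟨a, rfl⟩ := Ideal.Quotient.mk_surjective c
        rw [Set.mem_ofPred_eq, coe_mk_smul]
        exact hphi a hx }
  let κ := IsLocalRing.ResidueField v.valuationSubring
  let _ : Algebra (Fq[X] ⧸ Ideal.span {l}) κ :=
    (Ideal.Quotient.lift (Ideal.span {l}) (reduction v hv) fun a ha ↦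
      (reduction_eq_zero_iff hv a).2 ((hvl a).2 (Ideal.mem_span_singleton.1 ha))).toAlgebra
  let res := IsLocalRing.residue v.valuationSubring
  have hres : ∀ x y : v.valuationSubring, res x = res y ↔ v ((x : L) - y) < 1 := by
    intro x y
    rw [← sub_eq_zero, ← map_sub]
    exact residue_eq_zero_iff_valuation_lt_one _
  let j : W →ₗ[Fq[X] ⧸ Ideal.span {l}] κ :=
    { toFun := fun x ↦ res ⟨(x : L) / x₀, hdiv _ x.1.2 x.2⟩
      map_add' := fun x y ↦ by
        rw [← map_add]
        congr 1
        exact Subtype.ext (add_div _ _ _)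
      map_smul' := fun c x ↦ by
        obtain ⟨a, rfl⟩ := Ideal.Quotient.mk_surjective c
        rw [RingHom.id_apply, Algebra.smul_def]
        change _ = res _ * res _
        rw [← map_mul, hres]
        change v (((Ideal.Quotient.mk (Ideal.span {l}) a • x.1 : LinearMap.ker (phi r L l)) : L) /
          x₀ - algebraMap Fq[X] L a * (x / x₀)) < 1
        rw [coe_mk_smul]
        rcases eq_or_ne (x : L) 0 with h0 | h0
        · simp [h0]
        have h1 := valuation_phi_sub_lt r hr hv a h0 x.2
        have h2 : v ((x : L) / x₀) ≤ 1 := hdiv _ x.1.2 x.2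
        have h3 : 0 < v x₀ := by simpa [zero_lt_iff] using hx₀0
        rw [← mul_div_assoc, ← sub_div, map_div₀, div_lt_one₀ h3]
        rw [map_div₀, div_le_one₀ h3] at h2
        exact h1.trans_le h2 }
  have hj : Function.Injective j := by
    rw [injective_iff_map_eq_zero]
    intro x hx
    by_contra hx0
    have h0 : (x : L) ≠ 0 := fun h ↦ hx0 (Subtype.ext (Subtype.ext h))
    obtain ⟨σ, hσ, hσx⟩ := htrans x x.1.2 h0 x.2
    have h1 : v ((x : L) / x₀) < 1 := (residue_eq_zero_iff_valuation_lt_one _).1 hx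
    rw [← hσx, map_div₀, hIv σ hσ, div_self ((Valuation.ne_zero_iff v).2 hx₀0)] at h1
    exact lt_irrefl _ h1
  have hW : ∀ g ∈ torsionRep r (L := L) l F '' I, ∀ x ∈ W, g x ∈ W := by
    rintro _ ⟨σ, hσ, rfl⟩ x hx
    exact (hIv σ hσ x).trans_lt hx
  suffices h : ∃ g ∈ torsionRep r (L := L) l F '' I, LinearMap.det (g : LinearMap.ker (phi r L l) →ₗ[
      Fq[X] ⧸ Ideal.span {l}] LinearMap.ker (phi r L l)) = u by
    obtain ⟨_, ⟨σ, -, rfl⟩, h⟩ := h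
    exact ⟨σ, h⟩
  refine exists_det_eq_of_transitive W j hj (torsionRep r (L := L) l F '' I) ?_ hW
    ⟨⟨x₀, hx₀⟩, hx₀1⟩ ?_ ?_ ?_ hu
  · rintro _ ⟨σ, hσ, rfl⟩ x
    exact hIres σ hσ x (hint x x.2)
  · refine (hres _ 1).2 ?_
    simp [div_self hx₀0]
  · rintro _ ⟨σ, hσ, rfl⟩ x
    change res _ = res _ * res _
    rw [← map_mul, hres]
    change v (σ x / x₀ - σ x₀ / x₀ * (x / x₀)) < 1
    have hσx₀ : σ x₀ ≠ 0 := by simpa using hx₀0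
    have h1 : σ x / x₀ - σ x₀ / x₀ * (x / x₀) = σ x₀ / x₀ * (σ (x / x₀) - x / x₀) := by
      rw [map_div₀]
      field_simp
    rw [h1, map_mul, map_div₀, hIv σ hσ, div_self ((Valuation.ne_zero_iff v).2 hx₀0), one_mul]
    exact hIres σ hσ _ (hdiv _ x.1.2 x.2)
  · intro x hx
    have h0 : (x : L) ≠ 0 := fun h ↦ hx (Subtype.ext (Subtype.ext h))
    obtain ⟨σ, hσ, hσx⟩ := htrans x x.1.2 h0 x.2
    exact ⟨_, ⟨σ, hσ, rfl⟩, Subtype.ext hσx⟩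

/-- If `φ[l]` is irreducible, then the Galois representation on it is surjective. -/
theorem torsionRep_surjective [(Ideal.span {l}).IsMaximal]
    [IsFractionRing Fq[X] F] [FiniteDimensional F L] [IsGalois F L] [FaithfulSMul Fq[X] L]
    (hr : 2 ≤ r) (hl : Irreducible l) (hlX : ¬ l ∣ X) (hXl : ¬ X ∣ l)
    (hcard : Nat.card (LinearMap.ker (phi r L l)) = q ^ (r * l.natDegree))
    (hfaith : Function.Injective (torsionRep r (L := L) l F))
    (hirr : ∀ W : Submodule (Fq[X] ⧸ Ideal.span {l}) (LinearMap.ker (phi r L l)),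
      (∀ σ : L ≃ₐ[F] L, ∀ x ∈ W, torsionRep r l F σ x ∈ W) → W = ⊥ ∨ W = ⊤) :
    Function.Surjective (torsionRep r (L := L) l F) := by
  have hd := hl.natDegree_pos
  have hfin := finite_ker_phi (L := L) r hr hl.ne_zero
  have : Module.Finite (Fq[X] ⧸ Ideal.span {l}) (LinearMap.ker (phi r L l)) :=
    Module.Finite.of_finite
  obtain ⟨f, hf, htr⟩ := exists_transvection_mem_range (F := F) r hr hl.ne_zero hXl hd hcard hfaith
  rw [← MonoidHom.range_eq_top]
  refine eq_top_of_irreducible_of_transvection ?_ _ (fun W hW ↦ hirr W fun σ x hx ↦ ?_) f hf htr ?_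
  · rwa [finrank_torsion r hr hl.ne_zero hd hcard]
  · exact hW _ ⟨σ, rfl⟩ x hx
  · intro u hu
    obtain ⟨σ, hσ⟩ := exists_det_torsionRep_eq (F := F) r hr hl hlX hcard hu
    exact ⟨_, ⟨σ, rfl⟩, hσ⟩

end Image

section Transfer

variable (F L : Type*) {K : Type*} [Field F] [Field L] [Field K] {l : Fq[X]}
  [Algebra Fq L] [Algebra Fq[X] L] [IsScalarTower Fq Fq[X] L] [Algebra Fq F] [Algebra Fq[X] F]
  [IsScalarTower Fq Fq[X] F] [FaithfulSMul Fq[X] F] [Algebra F L] [IsScalarTower Fq[X] F L]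

theorem mem_rootSet_map_pol (hr : 2 ≤ r) (hl : l ≠ 0) (x : L) :
    x ∈ ((pol r l).map (algebraMap Fq[X] F)).rootSet L ↔ phi r L l x = 0 := by
  rw [mem_rootSet_of_ne (separable_map_pol r hr hl).ne_zero, aeval_map_algebraMap, aeval_pol]

theorem card_ker_phi [((pol r l).map (algebraMap Fq[X] F)).IsSplittingField F L]
    (hr : 2 ≤ r) (hl : l ≠ 0) :
    Nat.card (LinearMap.ker (phi r L l)) = q ^ (r * l.natDegree) := by
  rw [← natDegree_map_pol (L := F) r hr hl, ← card_rootSet_eq_natDegree (K := L)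
    (separable_map_pol r hr hl) (IsSplittingField.splits L _), ← Nat.card_eq_fintype_card]
  exact Nat.card_congr (Equiv.subtypeEquivRight fun x ↦ (mem_rootSet_map_pol r F L hr hl x).symm)

theorem torsionRep_injective [((pol r l).map (algebraMap Fq[X] F)).IsSplittingField F L]
    (hr : 2 ≤ r) (hl : l ≠ 0) : Function.Injective (torsionRep r (L := L) l F) := by
  intro σ τ h
  have h1 : (σ : L →ₐ[F] L) = τ := by
    refine AlgHom.ext_of_adjoin_eq_top
      (IsSplittingField.adjoin_rootSet L ((pol r l).map (algebraMap Fq[X] F))) fun x hx ↦ ?_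
    rw [mem_rootSet_map_pol r F L hr hl] at hx
    exact congrArg Subtype.val (LinearEquiv.congr_fun h ⟨x, hx⟩)
  exact AlgEquiv.ext fun x ↦ DFunLike.congr_fun h1 x

variable [Algebra Fq K] [Algebra Fq[X] K] [IsScalarTower Fq Fq[X] K] [Algebra F K]
  [IsScalarTower Fq[X] F K] [Algebra L K] [IsScalarTower F L K] [IsScalarTower Fq[X] L K]

theorem algebraMap_phi (a : Fq[X]) (x : L) :
    algebraMap L K (phi r L a x) = phi r K a (algebraMap L K x) :=
  map_phi r (IsScalarTower.toAlgHom Fq[X] L K) a x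

theorem exists_algebraMap_eq [((pol r l).map (algebraMap Fq[X] F)).IsSplittingField F L]
    (hr : 2 ≤ r) (hl : l ≠ 0) {x : K} (hx : phi r K l x = 0) :
    ∃ y : LinearMap.ker (phi r L l), algebraMap L K y = x := by
  rw [← mem_rootSet_map_pol r F K hr hl,
    ← (IsSplittingField.splits L ((pol r l).map (algebraMap Fq[X] F))).image_rootSet
      (IsScalarTower.toAlgHom F L K)] at hx
  obtain ⟨y, hy, rfl⟩ := hx
  exact ⟨⟨y, (mem_rootSet_map_pol r F L hr hl y).1 hy⟩, rfl⟩

theorem phi_algebraMap_eq_zero (y : LinearMap.ker (phi r L l)) :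
    phi r K l (algebraMap L K y) = 0 := by
  have h : phi r L l y = 0 := y.2
  rw [← algebraMap_phi r L, h, map_zero]

/-- Either `φ[l]` has a proper nonzero Galois-stable submodule, or every automorphism of the module
`φ[l]` comes from the Galois group. -/
theorem stable_or_surjective [IsFractionRing Fq[X] F]
    [((pol r l).map (algebraMap Fq[X] F)).IsSplittingField F L] [Normal F K]
    (hr : 2 ≤ r) (hl : Irreducible l) (hlX : ¬ l ∣ X) (hXl : ¬ X ∣ l) :
    (∃ V : Set K, (∀ x ∈ V, phi r K l x = 0) ∧ 0 ∈ V ∧ (∀ x ∈ V, ∀ y ∈ V, x + y ∈ V) ∧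
      (∀ b : Fq[X], ∀ x ∈ V, phi r K b x ∈ V) ∧ (∀ σ : K ≃ₐ[F] K, ∀ x ∈ V, σ x ∈ V) ∧
      V ≠ {0} ∧ V ≠ {x | phi r K l x = 0}) ∨
    ∀ g : K → K, Set.BijOn g {x | phi r K l x = 0} {x | phi r K l x = 0} →
      (∀ x y, phi r K l x = 0 → phi r K l y = 0 → g (x + y) = g x + g y) →
      (∀ (b : Fq[X]) x, phi r K l x = 0 → g (phi r K b x) = phi r K b (g x)) →
      ∃ σ : K ≃ₐ[F] K, ∀ x, phi r K l x = 0 → σ x = g x := by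
  have hl0 := hl.ne_zero
  have : (Ideal.span {l}).IsMaximal := PrincipalIdealRing.isMaximal_of_irreducible hl
  have : FiniteDimensional F L :=
    IsSplittingField.finiteDimensional L ((pol r l).map (algebraMap Fq[X] F))
  have : IsGalois F L := IsGalois.of_separable_splitting_field (separable_map_pol (L := F) r hr hl0)
  have : FaithfulSMul Fq[X] L := by
    rw [faithfulSMul_iff_algebraMap_injective, IsScalarTower.algebraMap_eq Fq[X] F L]
    exact (algebraMap F L).injective.comp (FaithfulSMul.algebraMap_injective Fq[X] F)
  have hinj := (algebraMap L K).injective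
  by_cases hirr : ∀ W : Submodule (Fq[X] ⧸ Ideal.span {l}) (LinearMap.ker (phi r L l)),
      (∀ σ : L ≃ₐ[F] L, ∀ x ∈ W, torsionRep r l F σ x ∈ W) → W = ⊥ ∨ W = ⊤
  · right
    intro g hg hadd hmul
    have hsurj := torsionRep_surjective (F := F) r hr hl hlX hXl (card_ker_phi r F L hr hl0)
      (torsionRep_injective r F L hr hl0) hirr
    let e : LinearMap.ker (phi r L l) ≃ {x | phi r K l x = 0} :=
      Equiv.ofBijective (fun y ↦ ⟨algebraMap L K y, phi_algebraMap_eq_zero r L y⟩)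
        ⟨fun x y h ↦ Subtype.ext (hinj (congrArg Subtype.val h)), fun x ↦ by
          obtain ⟨y, hy⟩ := exists_algebraMap_eq r F L hr hl0 x.2
          exact ⟨y, Subtype.ext hy⟩⟩
    let g₀ : LinearMap.ker (phi r L l) ≃ LinearMap.ker (phi r L l) :=
      e.trans ((hg.equiv g).trans e.symm)
    have hg₀ (x : LinearMap.ker (phi r L l)) :
        algebraMap L K (g₀ x) = g (algebraMap L K x) :=
      congrArg Subtype.val (e.apply_symm_apply (hg.equiv g (e x)))
    let g₁ : LinearMap.ker (phi r L l) ≃ₗ[Fq[X] ⧸ Ideal.span {l}] LinearMap.ker (phi r L l) :=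
      { g₀ with
        map_add' := fun x y ↦ Subtype.ext <| hinj <| by
          change algebraMap L K (g₀ (x + y)) = algebraMap L K ((g₀ x : L) + g₀ y)
          rw [map_add (algebraMap L K), hg₀, hg₀, hg₀, Submodule.coe_add, map_add]
          exact hadd _ _ (phi_algebraMap_eq_zero r L x) (phi_algebraMap_eq_zero r L y)
        map_smul' := fun c x ↦ Subtype.ext <| hinj <| by
          obtain ⟨a, rfl⟩ := Ideal.Quotient.mk_surjective c
          change algebraMap L K (g₀ (Ideal.Quotient.mk (Ideal.span {l}) a • x)) =
            algebraMap L K ((Ideal.Quotient.mk (Ideal.span {l}) a • g₀ x :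
              LinearMap.ker (phi r L l)) : L)
          rw [hg₀, coe_mk_smul, coe_mk_smul, algebraMap_phi r L, algebraMap_phi r L, hg₀]
          exact hmul _ _ (phi_algebraMap_eq_zero r L x) }
    obtain ⟨σ, hσ⟩ := hsurj g₁
    refine ⟨σ.liftNormal K, fun x hx ↦ ?_⟩
    obtain ⟨y, rfl⟩ := exists_algebraMap_eq r F L hr hl0 hx
    rw [AlgEquiv.liftNormal_commutes, ← hg₀]
    exact congrArg (algebraMap L K) (congrArg Subtype.val (LinearEquiv.congr_fun hσ y))
  · left
    push Not at hirr
    obtain ⟨W, hW, hbot, htop⟩ := hirr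
    refine ⟨(fun y : LinearMap.ker (phi r L l) ↦ algebraMap L K y) '' W, ?_, ⟨0, W.zero_mem, ?_⟩,
      ?_, ?_, ?_, fun h ↦ hbot ?_, fun h ↦ htop ?_⟩
    · rintro _ ⟨y, -, rfl⟩
      exact phi_algebraMap_eq_zero r L y
    · simp
    · rintro _ ⟨x, hx, rfl⟩ _ ⟨y, hy, rfl⟩
      exact ⟨x + y, W.add_mem hx hy, by simp⟩
    · rintro b _ ⟨x, hx, rfl⟩
      refine ⟨Ideal.Quotient.mk _ b • x, W.smul_mem _ hx, ?_⟩
      rw [← algebraMap_phi r L, ← coe_mk_smul]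
    · rintro σ _ ⟨x, hx, rfl⟩
      refine ⟨_, hW (σ.restrictNormal L) x hx, ?_⟩
      exact AlgEquiv.restrictNormal_commutes σ L x
    · refine (Submodule.eq_bot_iff _).2 fun x hx ↦ Subtype.ext (hinj ?_)
      have : algebraMap L K x ∈ ({0} : Set K) := h ▸ ⟨x, hx, rfl⟩
      simpa using this
    · refine (Submodule.eq_top_iff').2 fun x ↦ ?_
      have h1 : algebraMap L K x ∈ {x | phi r K l x = 0} := phi_algebraMap_eq_zero r L x
      rw [← h] at h1
      obtain ⟨y, hy, hyx⟩ := h1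
      rwa [← Subtype.ext (hinj hyx)]

end Transfer

end Drinfeld

/-- There is `c = c(r)` such that for `p > c`: for every nonzero prime `𝔩 = (l) ≠ (T)`,
the mod `𝔩` representation is either reducible (there is a Galois-stable proper nonzero
`𝔽_𝔩`-subspace of `φ[𝔩]`) or surjective (every `𝔽_𝔩`-linear automorphism of `φ[𝔩]` is
the restriction of some `σ ∈ Gal(F̄/F)`). -/
theorem mod_l_reducible_or_surjective (r : ℕ) (hr : r.Prime) (hr3 : 3 ≤ r) :
    ∃ c : ℕ, ∀ (p e q : ℕ), p.Prime → 5 ≤ p → c < p → 0 < e → q = p ^ e →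
    ∀ (Fq : Type) [Field Fq] [Fintype Fq], Fintype.card Fq = q →
    ∀ φ : Polynomial Fq →+* AddMonoid.End (Kbar Fq), IsDrinfeldPhi Fq q r φ →
    ∀ l : Polynomial Fq, l.Monic → Irreducible l → l ≠ X →
    (∃ V : Set (Kbar Fq), IsGaloisStableSubspace Fq φ l V ∧ V ≠ {0} ∧
        V ≠ phiTorsion Fq φ l) ∨
    (∀ g : Kbar Fq → Kbar Fq, IsTorsionAut Fq φ l g →
      ∃ σ : Kbar Fq ≃ₐ[RatFunc Fq] Kbar Fq, ∀ x ∈ phiTorsion Fq φ l, σ x = g x) := by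
  refine ⟨0, ?_⟩
  rintro p e q hp h5 hc he hq Fq _ _ rfl φ ⟨hC, hX⟩ l hmon hl hlX
  have hr2 : 2 ≤ r := by omega
  have hl0 := hl.ne_zero
  have hφ : ∀ (a : Fq[X]) (x : Kbar Fq), φ a x = Drinfeld.phi r (Kbar Fq) a x := by
    intro a x
    induction a using Drinfeld.induction_X_mul_add_C with
    | h0 => simp
    | h b c ih =>
      have h1 : φ (X * b + C c) x = φ X (φ b x) + φ (C c) x := by
        rw [map_add, map_mul]
        rfl
      rw [h1, Drinfeld.phi_X_mul_add_C, ← ih, hX, hC, Drinfeld.phiT_apply, Algebra.smul_def,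
        IsScalarTower.algebraMap_apply Fq[X] (RatFunc Fq) (Kbar Fq), RatFunc.algebraMap_X,
        IsScalarTower.algebraMap_apply Fq (RatFunc Fq) (Kbar Fq), RatFunc.algebraMap_eq_C]
  have hlX' : ¬ l ∣ X := fun h ↦
    hlX (eq_of_monic_of_associated hmon monic_X (hl.associated_of_dvd irreducible_X h))
  have hXl : ¬ X ∣ l := fun h ↦
    hlX (eq_of_monic_of_associated hmon monic_X (irreducible_X.associated_of_dvd hl h).symm)
  let P := (Drinfeld.pol r l).map (algebraMap Fq[X] (RatFunc Fq))
  let L := IntermediateField.adjoin (RatFunc Fq) (P.rootSet (Kbar Fq))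
  have : P.IsSplittingField (RatFunc Fq) L :=
    IntermediateField.adjoin_rootSet_isSplittingField (IsAlgClosed.splits _)
  have : IsScalarTower Fq Fq[X] L := IsScalarTower.of_algebraMap_eq fun c ↦
    Subtype.ext (IsScalarTower.algebraMap_apply Fq Fq[X] (Kbar Fq) c)
  have : IsScalarTower Fq[X] L (Kbar Fq) := IsScalarTower.of_algebraMap_eq fun _ ↦ rfl
  have hset : phiTorsion Fq φ l = {x | Drinfeld.phi r (Kbar Fq) l x = 0} :=
    Set.ext fun x ↦ (hφ l x).congr_left
  rcases Drinfeld.stable_or_surjective r (RatFunc Fq) L (K := Kbar Fq) hr2 hl hlX' hXl with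
    ⟨V, h1, h2, h3, h4, h5, h6, h7⟩ | h
  · refine Or.inl ⟨V, ⟨fun x hx ↦ hset ▸ h1 x hx, h2, h3, fun b x hx ↦ ?_, h5⟩, h6, hset ▸ h7⟩
    rw [hφ]
    exact h4 b x hx
  · refine Or.inr fun g ⟨hg, hadd, hmul⟩ ↦ ?_
    rw [hset] at hg hadd hmul ⊢
    refine h g hg (fun x y hx hy ↦ hadd x hx y hy) fun b x hx ↦ ?_
    rw [← hφ, ← hφ]
    exact hmul b x hx
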